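/- arXiv:2412.00669 — 4 statements merged into one kernel-verified Lean document; each statement's English description precedes it below -/
import Mathlib

section
/- Let (R, m, k) be a commutative noetherian local ring whose maximal ideal m is quasi-decomposable, and let t = depth R. Then Ω^{t+1}(k) is a direct summand of Ω^{t+2}(k). -/
universe u

/-- A minimal free resolution of the module `M` over `R`, where minimality is
measured with respect to the ideal `𝔪` (the maximal ideal in applications). -/
structure MinFreeRes (R : Type u) [CommRing R] (𝔪 : Ideal R)
    (M : Type u) [AddCommGroup M] [Module R M] : Type u where
  b : ℕ → ℕ
  aug : (Fin (b 0) → R) →ₗ[R] M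
  d : ∀ n : ℕ, (Fin (b (n + 1)) → R) →ₗ[R] (Fin (b n) → R)
  aug_surj : Function.Surjective aug
  exact_aug : LinearMap.range (d 0) = LinearMap.ker aug
  exact : ∀ n, LinearMap.range (d (n + 1)) = LinearMap.ker (d n)
  minimal : ∀ n, LinearMap.range (d n) ≤ 𝔪 • (⊤ : Submodule R (Fin (b n) → R))

namespace MinFreeRes

variable {R : Type u} [CommRing R] {𝔪 : Ideal R}
  {M : Type u} [AddCommGroup M] [Module R M]

/-- The `n`-th syzygy of `M` given by the minimal free resolution `F`:
`Syz 0 = M` and `Syz (n+1) = image of d n = ker of the previous map`. -/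
def Syz (F : MinFreeRes R 𝔪 M) : ℕ → Type u
  | 0 => M
  | n + 1 => ↥(LinearMap.range (F.d n))

instance (F : MinFreeRes R 𝔪 M) : ∀ n, AddCommGroup (F.Syz n)
  | 0 => inferInstanceAs (AddCommGroup M)
  | n + 1 => inferInstanceAs (AddCommGroup ↥(LinearMap.range (F.d n)))

instance (F : MinFreeRes R 𝔪 M) : ∀ n, Module R (F.Syz n)
  | 0 => inferInstanceAs (Module R M)
  | n + 1 => inferInstanceAs (Module R ↥(LinearMap.range (F.d n)))

/-- The Auslander transpose of `M` computed from the minimal free resolution `F`: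
the cokernel of the `R`-dual of the first differential. -/
def Tr (F : MinFreeRes R 𝔪 M) : Type u :=
  (Module.Dual R (Fin (F.b 1) → R)) ⧸ LinearMap.range ((F.d 0).dualMap)

instance (F : MinFreeRes R 𝔪 M) : AddCommGroup F.Tr :=
  inferInstanceAs (AddCommGroup
    ((Module.Dual R (Fin (F.b 1) → R)) ⧸ LinearMap.range ((F.d 0).dualMap)))

instance (F : MinFreeRes R 𝔪 M) : Module R F.Tr :=
  inferInstanceAs (Module R
    ((Module.Dual R (Fin (F.b 1) → R)) ⧸ LinearMap.range ((F.d 0).dualMap)))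

/-- `Ext¹_R(M, N)` computed from the minimal free resolution `F` of `M`:
the homology of `Hom(F₀,N) → Hom(F₁,N) → Hom(F₂,N)` in the middle spot. -/
def Ext1 (F : MinFreeRes R 𝔪 M) (N : Type u) [AddCommGroup N] [Module R N] : Type u :=
  ↥(LinearMap.ker (LinearMap.lcomp R N (F.d 1))) ⧸
    (LinearMap.range (LinearMap.lcomp R N (F.d 0))).comap
      (LinearMap.ker (LinearMap.lcomp R N (F.d 1))).subtype

instance (F : MinFreeRes R 𝔪 M) (N : Type u) [AddCommGroup N] [Module R N] :
    AddCommGroup (F.Ext1 N) :=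
  inferInstanceAs (AddCommGroup
    (↥(LinearMap.ker (LinearMap.lcomp R N (F.d 1))) ⧸
      (LinearMap.range (LinearMap.lcomp R N (F.d 0))).comap
        (LinearMap.ker (LinearMap.lcomp R N (F.d 1))).subtype))

instance (F : MinFreeRes R 𝔪 M) (N : Type u) [AddCommGroup N] [Module R N] :
    Module R (F.Ext1 N) :=
  inferInstanceAs (Module R
    (↥(LinearMap.ker (LinearMap.lcomp R N (F.d 1))) ⧸
      (LinearMap.range (LinearMap.lcomp R N (F.d 0))).comap
        (LinearMap.ker (LinearMap.lcomp R N (F.d 1))).subtype))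

end MinFreeRes

/-- `S` is (isomorphic to) a direct summand of `M` as an `R`-module. -/
def IsDirectSummand (R : Type u) [CommRing R] (S M : Type u)
    [AddCommGroup S] [Module R S] [AddCommGroup M] [Module R M] : Prop :=
  ∃ (i : S →ₗ[R] M) (p : M →ₗ[R] S), p ∘ₗ i = LinearMap.id

/-- `S` belongs to `add X`: it is a direct summand of a finite direct sum of copies of `X`. -/
def InAddClosure (R : Type u) [CommRing R] (S X : Type u)
    [AddCommGroup S] [Module R S] [AddCommGroup X] [Module R X] : Prop :=
  ∃ r : ℕ, IsDirectSummand R S (Fin r → X)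

/-- There exists a short exact sequence `0 → A → B → C → 0` of `R`-modules. -/
def ExistsSES (R : Type u) [CommRing R] (A B C : Type u)
    [AddCommGroup A] [Module R A] [AddCommGroup B] [Module R B]
    [AddCommGroup C] [Module R C] : Prop :=
  ∃ (i : A →ₗ[R] B) (p : B →ₗ[R] C),
    Function.Injective i ∧ Function.Surjective p ∧ LinearMap.range i = LinearMap.ker p

/-- The `R`-module `M` has depth (with respect to the ideal `𝔪`) equal to `t`:
there is an `M`-regular sequence of length `t` in `𝔪` and no longer one. -/
def HasDepth (R : Type u) [CommRing R] (𝔪 : Ideal R) (M : Type u)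
    [AddCommGroup M] [Module R M] (t : ℕ) : Prop :=
  (∃ rs : List R, rs.length = t ∧ (∀ x ∈ rs, x ∈ 𝔪) ∧ RingTheory.Sequence.IsRegular M rs) ∧
  ∀ rs : List R, (∀ x ∈ rs, x ∈ 𝔪) → RingTheory.Sequence.IsRegular M rs → rs.length ≤ t

/-- `𝔪` needs at least (and exactly) `e` generators. -/
def HasMinGens (R : Type u) [CommRing R] (𝔪 : Ideal R) (e : ℕ) : Prop :=
  (∃ s : Finset R, s.card = e ∧ Ideal.span (s : Set R) = 𝔪) ∧
  ∀ s : Finset R, Ideal.span (s : Set R) = 𝔪 → e ≤ s.card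

/-- `R` is a regular local ring with maximal ideal `𝔪`: `𝔪` is generated by
`dim R` elements. -/
def IsRegularWrt (R : Type u) [CommRing R] (𝔪 : Ideal R) : Prop :=
  ∃ s : Finset R, Ideal.span (s : Set R) = 𝔪 ∧ (s.card : WithBot ℕ∞) = ringKrullDim R

/-- The local ring `(R, 𝔪)` of dimension `d` has Hilbert–Samuel multiplicity `e`:
the function `n ↦ length (R / 𝔪^(n+1))` eventually agrees with a polynomial of
degree `d` whose leading coefficient is `e / d!`. -/
def HasHSMultiplicity (R : Type u) [CommRing R] (𝔪 : Ideal R) (d e : ℕ) : Prop :=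
  ∃ p : Polynomial ℚ, p.natDegree = d ∧ p.leadingCoeff * (d.factorial : ℚ) = e ∧
    ∀ᶠ n : ℕ in Filter.atTop, ∃ l : ℕ,
      Order.krullDim (Submodule R (R ⧸ 𝔪 ^ (n + 1))) = l ∧ (l : ℚ) = p.eval (n : ℚ)

/-- `X` is a direct summand of `Y` up to projective summands. -/
def IsStableSummand (R : Type u) [CommRing R] (X Y : Type u)
    [AddCommGroup X] [Module R X] [AddCommGroup Y] [Module R Y] : Prop :=
  ∃ (G : Type u) (_ : AddCommGroup G) (_ : Module R G),
    Module.Projective R G ∧ IsDirectSummand R X (Y × G)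

/-- `K` is the kernel of a surjection from a projective module onto `X`. -/
def IsSyzygy (R : Type u) [CommRing R] (K X : Type u)
    [AddCommGroup K] [Module R K] [AddCommGroup X] [Module R X] : Prop :=
  ∃ (P : Type u) (_ : AddCommGroup P) (_ : Module R P) (ι : K →ₗ[R] P) (π : P →ₗ[R] X),
    Module.Projective R P ∧ Function.Injective ι ∧ Function.Surjective π ∧
      LinearMap.range ι = LinearMap.ker π

/-- `K` is an `n`-th syzygy of `X`, not necessarily minimal. -/
def IsNthSyzygy (R : Type u) [CommRing R] : ℕ → ∀ (K X : Type u)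
    [AddCommGroup K] [Module R K] [AddCommGroup X] [Module R X], Prop
  | 0, K, X, _, _, _, _ => Nonempty (K ≃ₗ[R] X)
  | n + 1, K, X, _, _, _, _ => ∃ (Y : Type u) (_ : AddCommGroup Y) (_ : Module R Y),
      IsSyzygy R Y X ∧ IsNthSyzygy R n K Y

section Syzygies

variable {R : Type u} [CommRing R] {A K L X Y Z : Type u}
  [AddCommGroup A] [Module R A]
  [AddCommGroup K] [Module R K] [AddCommGroup L] [Module R L] [AddCommGroup X] [Module R X]
  [AddCommGroup Y] [Module R Y] [AddCommGroup Z] [Module R Z]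

lemma LinearMap.exists_comp_eq_of_range_le {ι : K →ₗ[R] X} (hι : Function.Injective ι)
    (f : A →ₗ[R] X) (hf : LinearMap.range f ≤ LinearMap.range ι) :
    ∃ g : A →ₗ[R] K, ι ∘ₗ g = f := by
  refine ⟨(LinearEquiv.ofInjective ι hι).symm.toLinearMap ∘ₗ
    f.codRestrict (LinearMap.range ι) fun a => hf ⟨a, rfl⟩, ?_⟩
  ext a
  have := congrArg Subtype.val ((LinearEquiv.ofInjective ι hι).apply_symm_apply
    (f.codRestrict (LinearMap.range ι) (fun a => hf ⟨a, rfl⟩) a))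
  exact this

lemma IsDirectSummand.isStableSummand (h : IsDirectSummand R X Y) : IsStableSummand R X Y := by
  obtain ⟨i, p, h⟩ := h
  refine ⟨PUnit.{u + 1}, inferInstance, inferInstance, inferInstance,
    LinearMap.inl R Y PUnit.{u + 1} ∘ₗ i, p ∘ₗ LinearMap.fst R Y PUnit.{u + 1}, ?_⟩
  ext x
  simpa using LinearMap.congr_fun h x

lemma LinearEquiv.isDirectSummand (e : X ≃ₗ[R] Y) : IsDirectSummand R X Y :=
  ⟨e, e.symm, by ext; simp⟩

lemma IsStableSummand.trans (h₁ : IsStableSummand R X Y) (h₂ : IsStableSummand R Y Z) :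
    IsStableSummand R X Z := by
  obtain ⟨G, _, _, hG, i, p, h₁⟩ := h₁
  obtain ⟨H, _, _, hH, j, q, h₂⟩ := h₂
  let e := LinearEquiv.prodAssoc R Z H G
  refine ⟨H × G, inferInstance, inferInstance, inferInstance,
    e.toLinearMap ∘ₗ j.prodMap LinearMap.id ∘ₗ i,
    p ∘ₗ q.prodMap LinearMap.id ∘ₗ e.symm.toLinearMap, ?_⟩
  ext x
  have h₂' : ∀ y, q (j y) = y := fun y => LinearMap.congr_fun h₂ y
  have h₁' : p (i x) = x := LinearMap.congr_fun h₁ x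
  have : q.prodMap LinearMap.id (j.prodMap LinearMap.id (i x)) = i x := by
    ext <;> simp [h₂']
  simp only [LinearMap.comp_apply, LinearEquiv.coe_coe, LinearEquiv.symm_apply_apply, this, h₁',
    LinearMap.id_apply]

lemma IsSyzygy.congr (h : IsSyzygy R K X) (e : L ≃ₗ[R] K) (f : X ≃ₗ[R] Y) : IsSyzygy R L Y := by
  obtain ⟨P, _, _, ι, π, hP, hι, hπ, h⟩ := h
  refine ⟨P, inferInstance, inferInstance, ι ∘ₗ e.toLinearMap, f.toLinearMap ∘ₗ π, hP,
    by simpa using hι, by simpa using hπ, ?_⟩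
  rw [LinearMap.range_comp_of_range_eq_top _ e.range, h, LinearMap.ker_comp_of_ker_eq_bot _ f.ker]

lemma isSyzygy_ker [Module.Projective R A] (π : A →ₗ[R] X) (hπ : Function.Surjective π) :
    IsSyzygy R (LinearMap.ker π) X :=
  ⟨A, inferInstance, inferInstance, (LinearMap.ker π).subtype, π, inferInstance,
    Subtype.val_injective, hπ, by simp⟩

lemma exists_isSyzygy (R : Type u) [CommRing R] (X : Type u) [AddCommGroup X] [Module R X] :
    ∃ (K : Type u) (_ : AddCommGroup K) (_ : Module R K), IsSyzygy R K X :=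
  ⟨_, inferInstance, inferInstance,
    isSyzygy_ker _ (Finsupp.linearCombination_id_surjective R X)⟩

/-- Taking syzygies preserves stable summands. -/
lemma IsSyzygy.isStableSummand (hK : IsSyzygy R K X) (hL : IsSyzygy R L Y)
    (h : IsStableSummand R X Y) : IsStableSummand R K L := by
  obtain ⟨G, _, _, hG, i, p, hpi⟩ := h
  obtain ⟨P, _, _, ι, π, hP, hι, hπ, hP'⟩ := hK
  obtain ⟨Q, _, _, κ, ρ, hQ, hκ, hρ, hQ'⟩ := hL
  have hπι (k) : π (ι k) = 0 := LinearMap.mem_ker.1 (hP' ▸ ⟨k, rfl⟩)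
  have hρκ (l) : ρ (κ l) = 0 := LinearMap.mem_ker.1 (hQ' ▸ ⟨l, rfl⟩)
  let ρ' : Q × G →ₗ[R] Y × G := ρ.prodMap LinearMap.id
  have hρ' : Function.Surjective ρ' := hρ.prodMap Function.surjective_id
  obtain ⟨i', hi'⟩ := Module.projective_lifting_property ρ' (i ∘ₗ π) hρ'
  obtain ⟨p', hp'⟩ := Module.projective_lifting_property π (p ∘ₗ ρ') hπ
  replace hi' (x) : ρ' (i' x) = i (π x) := LinearMap.congr_fun hi' x
  replace hp' (x) : π (p' x) = p (ρ' x) := LinearMap.congr_fun hp' x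
  replace hpi (x) : p (i x) = x := LinearMap.congr_fun hpi x
  let κ' : L →ₗ[R] Q × G := LinearMap.inl R Q G ∘ₗ κ
  have hκ' : Function.Injective κ' := LinearMap.inl_injective.comp hκ
  obtain ⟨iK, hiK⟩ := LinearMap.exists_comp_eq_of_range_le hκ' (i' ∘ₗ ι) <| by
    rintro _ ⟨k, rfl⟩
    have h0 : ρ' (i' (ι k)) = 0 := by rw [hi', hπι, map_zero]
    have h1 : (i' (ι k)).1 ∈ LinearMap.range κ := hQ' ▸ congrArg Prod.fst h0
    obtain ⟨l, hl⟩ := h1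
    exact ⟨l, Prod.ext hl (congrArg Prod.snd h0).symm⟩
  obtain ⟨pL, hpL⟩ := LinearMap.exists_comp_eq_of_range_le hι (p' ∘ₗ κ') <| by
    rintro _ ⟨l, rfl⟩
    rw [hP']
    have : ρ' (κ' l) = 0 := Prod.ext (hρκ l) rfl
    simp [hp', this]
  obtain ⟨s, hs⟩ := LinearMap.exists_comp_eq_of_range_le hι (LinearMap.id - p' ∘ₗ i') <| by
    rintro _ ⟨x, rfl⟩
    rw [hP']
    simp [hp', hi', hpi]
  replace hiK (x) : κ' (iK x) = i' (ι x) := LinearMap.congr_fun hiK x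
  replace hpL (x) : ι (pL x) = p' (κ' x) := LinearMap.congr_fun hpL x
  replace hs (x) : ι (s x) = x - p' (i' x) := LinearMap.congr_fun hs x
  refine ⟨P, inferInstance, inferInstance, hP, iK.prod ι, pL.coprod s, ?_⟩
  ext k
  apply hι
  simp [hpL, hiK, hs]

lemma exists_isNthSyzygy (R : Type u) [CommRing R] (n : ℕ) :
    ∀ (X : Type u) [AddCommGroup X] [Module R X],
    ∃ (K : Type u) (_ : AddCommGroup K) (_ : Module R K), IsNthSyzygy R n K X := by
  induction n with
  | zero => exact fun X _ _ => ⟨X, inferInstance, inferInstance, ⟨LinearEquiv.refl R X⟩⟩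
  | succ n ih =>
    intro X _ _
    obtain ⟨Y, _, _, hY⟩ := exists_isSyzygy R X
    obtain ⟨K, _, _, hK⟩ := ih Y
    exact ⟨K, _, _, Y, _, _, hY, hK⟩

lemma IsNthSyzygy.isStableSummand {n : ℕ} : ∀ {X Y : Type u} [AddCommGroup X] [Module R X]
    [AddCommGroup Y] [Module R Y], IsNthSyzygy R n K X → IsNthSyzygy R n L Y →
    IsStableSummand R X Y → IsStableSummand R K L := by
  induction n with
  | zero =>
    rintro X Y _ _ _ _ ⟨e⟩ ⟨f⟩ h
    exact (e.isDirectSummand.isStableSummand.trans h).trans f.symm.isDirectSummand.isStableSummand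
  | succ n ih =>
    rintro X Y _ _ _ _ ⟨X', _, _, hX', hK⟩ ⟨Y', _, _, hY', hL⟩ h
    exact ih hK hL (hX'.isStableSummand hY' h)

lemma IsNthSyzygy.succ {n : ℕ} : ∀ {X : Type u} [AddCommGroup X] [Module R X],
    IsNthSyzygy R n K X → IsSyzygy R L K → IsNthSyzygy R (n + 1) L X := by
  induction n with
  | zero =>
    rintro X _ _ ⟨e⟩ h
    exact ⟨L, inferInstance, inferInstance, h.congr (LinearEquiv.refl R L) e,
      ⟨LinearEquiv.refl R L⟩⟩
  | succ n ih =>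
    rintro X _ _ ⟨X', _, _, hX', hK⟩ h
    exact ⟨X', _, _, hX', ih hK h⟩

open CategoryTheory in
/-- Dimension shifting along a short exact sequence `0 → A → B → C → 0` whose middle term has
projective dimension at most `n`. -/
lemma IsNthSyzygy.isStableSummand_of_exact {n : ℕ} : ∀ {A B C : Type u}
    [AddCommGroup A] [Module R A] [AddCommGroup B] [Module R B] [AddCommGroup C] [Module R C]
    (f : A →ₗ[R] B) (g : B →ₗ[R] C), Function.Injective f → Function.Surjective g →
    LinearMap.range f = LinearMap.ker g → HasProjectiveDimensionLT (ModuleCat.of R B) (n + 1) →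
    IsNthSyzygy R n K A → IsNthSyzygy R (n + 1) L C →
    IsStableSummand R K L ∧ IsStableSummand R L K := by
  induction n with
  | zero =>
    rintro A B C _ _ _ _ _ _ f g hf hg hfg hB ⟨e⟩ ⟨C', _, _, hC', ⟨e'⟩⟩
    have : Module.Projective R B := by
      rw [← projective_iff_hasProjectiveDimensionLT_one] at hB
      exact (IsProjective.iff_projective B).2 hB
    have hK : IsSyzygy R K C := IsSyzygy.congr
      ⟨B, inferInstance, inferInstance, f, g, inferInstance, hf, hg, hfg⟩ e (LinearEquiv.refl R C)
    have hL : IsSyzygy R L C := hC'.congr e' (LinearEquiv.refl R C)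
    have hC := (LinearEquiv.refl R C).isDirectSummand.isStableSummand
    exact ⟨hK.isStableSummand hL hC, hL.isStableSummand hK hC⟩
  | succ n ih =>
    rintro A B C _ _ _ _ _ _ f g hf hg hfg hB ⟨A', _, _, ⟨P, _, _, ι, π, hP, hι, hπ, hP'⟩, hK⟩
      ⟨C', _, _, ⟨Q, _, _, κ, ρ, hQ, hκ, hρ, hQ'⟩, hL⟩
    have hπι (k) : π (ι k) = 0 := LinearMap.mem_ker.1 (hP' ▸ ⟨k, rfl⟩)
    have hgf (k) : g (f k) = 0 := LinearMap.mem_ker.1 (hfg ▸ ⟨k, rfl⟩)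
    have hρκ (l) : ρ (κ l) = 0 := LinearMap.mem_ker.1 (hQ' ▸ ⟨l, rfl⟩)
    obtain ⟨l, hl⟩ := Module.projective_lifting_property g ρ hg
    replace hl (x) : g (l x) = ρ x := LinearMap.congr_fun hl x
    let σ : P × Q →ₗ[R] B := (f ∘ₗ π).coprod l
    have hσ : Function.Surjective σ := by
      intro b
      obtain ⟨q, hq⟩ := hρ (g b)
      have : b - l q ∈ LinearMap.range f := by
        rw [hfg]; simp [hl, hq]
      obtain ⟨a, ha⟩ := this
      obtain ⟨p, rfl⟩ := hπ a
      exact ⟨(p, q), by simp [σ, ha]⟩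
    have hσ' (x : LinearMap.ker σ) : f (π x.1.1) + l x.1.2 = 0 := x.2
    let α : A' →ₗ[R] LinearMap.ker σ :=
      (LinearMap.inl R P Q ∘ₗ ι).codRestrict _ fun a => by simp [σ, hπι]
    obtain ⟨β, hβ⟩ := LinearMap.exists_comp_eq_of_range_le hκ
      (LinearMap.snd R P Q ∘ₗ (LinearMap.ker σ).subtype) <| by
      rintro _ ⟨x, rfl⟩
      rw [hQ', LinearMap.mem_ker, ← hl]
      simpa [hgf] using congrArg g (hσ' x)
    replace hβ (x) : κ (β x) = x.1.2 := LinearMap.congr_fun hβ x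
    refine ih α β (fun a a' h => hι (congrArg (fun x => x.1.1) h)) ?_ ?_ ?_ hK hL
    · intro c
      have : l (κ c) ∈ LinearMap.range f := by
        rw [hfg]; simp [hl, hρκ]
      obtain ⟨a, ha⟩ := this
      obtain ⟨p, rfl⟩ := hπ a
      refine ⟨⟨(-p, κ c), by simp [σ, ha]⟩, hκ ?_⟩
      rw [hβ]
    · apply le_antisymm
      · rintro _ ⟨a, rfl⟩
        exact hκ ((hβ _).trans (map_zero κ).symm)
      · intro x hx
        have h2 : x.1.2 = 0 := by rw [← hβ, LinearMap.mem_ker.1 hx, map_zero]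
        have h1 : π x.1.1 = 0 := hf (by simpa [h2] using hσ' x)
        obtain ⟨a, ha⟩ : x.1.1 ∈ LinearMap.range ι := hP' ▸ h1
        exact ⟨a, Subtype.ext (Prod.ext ha h2.symm)⟩
    · exact ((LinearMap.shortExact_shortComplexKer hσ).hasProjectiveDimensionLT_X₃_iff n
        ((IsProjective.iff_projective (P × Q)).1 inferInstance)).1 hB

end Syzygies

section LocalRing

open IsLocalRing RingTheory.Sequence

variable {R : Type u} [CommRing R] {M : Type u} [AddCommGroup M] [Module R M]

lemma isWeaklyRegular_concat_iff_self (rs : List R) (y : R) :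
    IsWeaklyRegular R (rs ++ [y]) ↔
      IsWeaklyRegular R rs ∧ ∀ r, y * r ∈ Ideal.ofList rs → r ∈ Ideal.ofList rs := by
  rw [isWeaklyRegular_append_iff, isWeaklyRegular_singleton_iff]
  refine and_congr_right fun _ => ?_
  rw [isSMulRegular_iff_right_eq_zero_of_smul]
  refine (Submodule.Quotient.mk_surjective _).forall.trans (forall_congr' fun r => ?_)
  rw [← Submodule.Quotient.mk_smul, Submodule.Quotient.mk_eq_zero, Submodule.Quotient.mk_eq_zero]
  simp

namespace MinFreeRes

variable {𝔪 : Ideal R}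

lemma isSyzygy_syz (F : MinFreeRes R 𝔪 M) : ∀ n, IsSyzygy R (F.Syz (n + 1)) (F.Syz n)
  | 0 => ⟨Fin (F.b 0) → R, inferInstance, inferInstance, (LinearMap.range (F.d 0)).subtype, F.aug,
      inferInstance, Subtype.val_injective, F.aug_surj,
      (Submodule.range_subtype _).trans F.exact_aug⟩
  | n + 1 => ⟨Fin (F.b (n + 1)) → R, inferInstance, inferInstance,
      (LinearMap.range (F.d (n + 1))).subtype, (F.d n).rangeRestrict,
      inferInstance, Subtype.val_injective, (F.d n).surjective_rangeRestrict,
      (Submodule.range_subtype _).trans ((F.exact n).trans (F.d n).ker_rangeRestrict.symm)⟩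

lemma isNthSyzygy_syz (F : MinFreeRes R 𝔪 M) (n : ℕ) : IsNthSyzygy R n (F.Syz n) M := by
  induction n with
  | zero => exact ⟨LinearEquiv.refl R M⟩
  | succ n ih => exact ih.succ (F.isSyzygy_syz n)

/-- Modulo a regular sequence of length at most `n`, the resolution stays exact in
degree `n + 1`. -/
lemma exact_mod_ofList (F : MinFreeRes R 𝔪 M) (rs : List R) (hrs : IsWeaklyRegular R rs) :
    ∀ n, rs.length ≤ n → ∀ a, (∀ j, F.d n a j ∈ Ideal.ofList rs) →
      ∃ c, ∀ j, (a - F.d (n + 1) c) j ∈ Ideal.ofList rs := by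
  induction rs using List.reverseRecOn with
  | nil =>
    intro n _ a ha
    have : a ∈ LinearMap.range (F.d (n + 1)) := by
      rw [F.exact, LinearMap.mem_ker]
      ext j
      simpa using ha j
    obtain ⟨c, rfl⟩ := this
    exact ⟨c, by simp⟩
  | append_singleton rs y ih =>
    rw [isWeaklyRegular_concat_iff_self] at hrs
    intro n hn a ha
    simp only [List.length_append, List.length_singleton] at hn
    obtain ⟨n, rfl⟩ := Nat.exists_eq_succ_of_ne_zero (by omega : n ≠ 0)
    have hsplit (r : R) :
        r ∈ Ideal.ofList (rs ++ [y]) ↔ ∃ b, r - y * b ∈ Ideal.ofList rs := by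
      rw [Ideal.ofList_append, Ideal.ofList_singleton, Submodule.mem_sup]
      constructor
      · rintro ⟨u, hu, v, hv, rfl⟩
        obtain ⟨b, rfl⟩ := Ideal.mem_span_singleton'.1 hv
        exact ⟨b, by simpa [mul_comm] using hu⟩
      · rintro ⟨b, hb⟩
        exact ⟨_, hb, y * b, Ideal.mul_mem_right _ _ (Ideal.mem_span_singleton_self y), by ring⟩
    simp only [hsplit] at ha ⊢
    choose b hb using ha
    have hb' (j) : (F.d (n + 1) a - y • b) j ∈ Ideal.ofList rs := hb j
    have hdd (x) : F.d n (F.d (n + 1) x) = 0 :=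
      LinearMap.mem_ker.1 (F.exact n ▸ LinearMap.mem_range_self _ x)
    have hdb (j) : F.d n b j ∈ Ideal.ofList rs := by
      apply hrs.2
      have := Ideal.map_pi _ _ hb' (F.d n) j
      simpa [hdd] using this
    obtain ⟨c, hc⟩ := ih hrs.1 n (by omega) b hdb
    obtain ⟨e, he⟩ := ih hrs.1 (n + 1) (by omega) (a - y • c) fun j => by
      have := add_mem (hb' j) (Ideal.mul_mem_left _ y (hc j))
      simp only [map_sub, map_smul, Pi.sub_apply, Pi.smul_apply, smul_eq_mul] at this ⊢
      convert this using 1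
      ring
    refine ⟨e, fun j => ⟨c j, ?_⟩⟩
    have := he j
    simp only [Pi.sub_apply, Pi.smul_apply, smul_eq_mul] at this ⊢
    convert this using 1
    ring

end MinFreeRes

lemma LinearMap.apply_mem_of_forall_mem {ι : Type*} [Finite ι] (I : Ideal R) (x : ι → R)
    (hx : ∀ i, x i ∈ I) (f : (ι → R) →ₗ[R] R) : f x ∈ I :=
  Ideal.map_pi I x hx (LinearMap.pi fun _ : Unit => f) ()

lemma exists_apply_eq_one_residueField [IsLocalRing R] (A : Type u) [AddCommGroup A] [Module R A]
    [Module.Finite R A] [Nontrivial A] : ∃ (f : A →ₗ[R] ResidueField R) (a : A), f a = 1 := by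
  obtain ⟨N, hN⟩ := IsCoatomic.exists_coatom (Submodule R A)
  obtain ⟨I, hI, ⟨e⟩⟩ := isSimpleModule_iff_quot_maximal.1 (isSimpleModule_iff_isCoatom.2 hN)
  obtain rfl := IsLocalRing.eq_maximalIdeal hI
  let e' : (A ⧸ N) ≃ₗ[R] ResidueField R := e
  obtain ⟨a, ha⟩ := Submodule.mkQ_surjective N (e'.symm 1)
  exact ⟨e'.toLinearMap ∘ₗ N.mkQ, a, by simp [ha]⟩

variable [IsLocalRing R] [IsNoetherianRing R]

lemma HasDepth.exists_socle {t : ℕ} (ht : HasDepth R (maximalIdeal R) R t) :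
    ∃ rs : List R, rs.length = t ∧ IsWeaklyRegular R rs ∧
      ∃ z ∉ Ideal.ofList rs, ∀ r ∈ maximalIdeal R, r * z ∈ Ideal.ofList rs := by
  obtain ⟨⟨rs, hlen, hmem, hreg⟩, hmax⟩ := ht
  refine ⟨rs, hlen, hreg.toIsWeaklyRegular, ?_⟩
  have hzd (r) (hr : r ∈ maximalIdeal R) :
      ∃ x : R ⧸ Ideal.ofList rs, x ≠ 0 ∧ r • x = 0 := by
    by_contra! h
    have hmem' : ∀ x ∈ rs ++ [r], x ∈ maximalIdeal R := by
      simpa [or_imp, forall_and] using ⟨hmem, hr⟩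
    have : IsRegular R (rs ++ [r]) := by
      rw [isRegular_iff_isWeaklyRegular_of_subset_maximalIdeal hmem',
        isWeaklyRegular_concat_iff_self]
      refine ⟨hreg.toIsWeaklyRegular, fun s hs => ?_⟩
      by_contra hs'
      exact h (Submodule.Quotient.mk s) (by rwa [Ne, Submodule.Quotient.mk_eq_zero])
        (by rwa [← Submodule.Quotient.mk_smul, Submodule.Quotient.mk_eq_zero, smul_eq_mul])
    have := hmax _ hmem' this
    simp [hlen] at this
  obtain ⟨P, hP, hle⟩ := ((maximalIdeal R).subset_union_prime_finite
    (associatedPrimes.finite R (R ⧸ Ideal.ofList rs)) (f := id) 0 0 fun _ h _ _ ↦ h.1).1 <| by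
      simp only [id]
      rw [biUnion_associatedPrimes_eq_zero_divisors]
      exact hzd
  obtain ⟨hprime, x, hx⟩ := isAssociatedPrime_iff.1 hP
  obtain ⟨z, rfl⟩ := Submodule.Quotient.mk_surjective _ x
  have hcolon (r : R) : r ∈ P ↔ r * z ∈ Ideal.ofList rs := by
    rw [hx, Submodule.mem_colon_singleton, ← Submodule.Quotient.mk_smul, Submodule.mem_bot,
      Submodule.Quotient.mk_eq_zero, smul_eq_mul]
  refine ⟨z, fun hz => hprime.ne_top ?_, fun r hr => (hcolon r).1 (hle hr)⟩
  rw [Ideal.eq_top_iff_one, hcolon, one_mul]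
  exact hz

/-- The syzygy following the depth of the ring has no nonzero free summand. -/
lemma MinFreeRes.apply_mem_maximalIdeal (F : MinFreeRes R (maximalIdeal R) M) {t : ℕ}
    (ht : HasDepth R (maximalIdeal R) R t) (φ : F.Syz (t + 1) →ₗ[R] R) (w : F.Syz (t + 1)) :
    φ w ∈ maximalIdeal R := by
  obtain ⟨rs, hlen, hreg, z, hz, hmz⟩ := ht.exists_socle
  by_contra hw
  have hu : IsUnit (φ w) := by simpa using hw
  obtain ⟨a, ha⟩ := (F.d t).surjective_rangeRestrict w
  have hmin (j) : F.d t a j ∈ maximalIdeal R :=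
    Submodule.smul_induction_on (p := fun x : Fin (F.b t) → R => x j ∈ maximalIdeal R)
      (F.minimal t (LinearMap.mem_range_self _ a))
      (fun r hr x _ => Ideal.mul_mem_right _ _ hr) (fun _ _ => add_mem)
  obtain ⟨c, hc⟩ := F.exact_mod_ofList rs hreg t hlen.le (z • a) fun j => by
    rw [map_smul, Pi.smul_apply, smul_eq_mul, mul_comm]
    exact hmz _ (hmin j)
  have h0 : (F.d t).rangeRestrict (F.d (t + 1) c) = 0 := by
    apply Subtype.ext
    exact LinearMap.mem_ker.1 (F.exact t ▸ LinearMap.mem_range_self _ c)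
  have := LinearMap.apply_mem_of_forall_mem _ _ hc
    ((show LinearMap.range (F.d t) →ₗ[R] R from φ) ∘ₗ (F.d t).rangeRestrict)
  rw [LinearMap.comp_apply, map_sub, map_smul, h0, sub_zero, ha] at this
  have h' : z * φ w ∈ Ideal.ofList rs := by
    rw [← smul_eq_mul, ← map_smul]; exact this
  exact hz ((Ideal.mul_unit_mem_iff_mem _ hu).1 h')

lemma IsStableSummand.isDirectSummand {X Y : Type u} [AddCommGroup X] [Module R X]
    [AddCommGroup Y] [Module R Y] [Module.Finite R X] (h : IsStableSummand R X Y)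
    (hX : ∀ (φ : X →ₗ[R] R) x, φ x ∈ maximalIdeal R) : IsDirectSummand R X Y := by
  obtain ⟨G, _, _, hG, i, p, hpi⟩ := h
  replace hpi (x) : p (i x) = x := LinearMap.congr_fun hpi x
  obtain ⟨s, hs⟩ := Module.projective_def'.1 hG
  let θ : X →ₗ[R] X := (p ∘ₗ LinearMap.inl R Y G) ∘ₗ LinearMap.fst R Y G ∘ₗ i
  have hθ (x : X) : x - θ x ∈ maximalIdeal R • (⊤ : Submodule R X) := by
    have h1 : x - θ x = (p ∘ₗ LinearMap.inr R Y G) (i x).2 := by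
      nth_rw 1 [← hpi x]
      simp only [θ, LinearMap.comp_apply, ← map_sub]
      congr 1
      ext <;> simp
    have h2 : Finsupp.linearCombination R id (s (i x).2) = (i x).2 := LinearMap.congr_fun hs _
    rw [h1, ← h2, Finsupp.linearCombination_apply, Finsupp.sum, map_sum]
    refine Submodule.sum_mem _ fun g _ => ?_
    rw [map_smul]
    exact Submodule.smul_mem_smul
      (hX (Finsupp.lapply g ∘ₗ s ∘ₗ LinearMap.snd R Y G ∘ₗ i) x) trivial
  have hsurj : Function.Surjective θ := by
    rw [← LinearMap.range_eq_top, eq_top_iff]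
    refine Submodule.le_of_le_smul_of_le_jacobson_bot Module.Finite.fg_top
      (maximalIdeal_le_jacobson _) fun x _ => ?_
    rw [← add_sub_cancel (θ x) x]
    exact Submodule.add_mem_sup ⟨x, rfl⟩ (hθ x)
  let e := LinearEquiv.ofBijective θ (IsNoetherian.bijective_of_surjective_endomorphism θ hsurj)
  refine ⟨LinearMap.fst R Y G ∘ₗ i, e.symm.toLinearMap ∘ₗ p ∘ₗ LinearMap.inl R Y G, ?_⟩
  ext x
  exact e.symm_apply_apply x

open CategoryTheory in
lemma hasProjectiveDimensionLT_quotient_ofList_smul_top {rs : List R}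
    (hrs : IsWeaklyRegular R rs) (hmem : ∀ r ∈ rs, r ∈ maximalIdeal R) (G : Type u)
    [AddCommGroup G] [Module R G] [Module.Projective R G] [Module.Finite R G] [Nontrivial G] :
    HasProjectiveDimensionLT (ModuleCat.of R (G ⧸ (Ideal.ofList rs • ⊤ : Submodule R G)))
      (rs.length + 1) := by
  have hG : IsWeaklyRegular G rs :=
    ((TensorProduct.rid R G).isWeaklyRegular_congr rs).1 hrs.isWeaklyRegular_lTensor
  have hproj : Projective (ModuleCat.of R G) := (IsProjective.iff_projective G).1 inferInstance
  have hpd : projectiveDimension (ModuleCat.of R G) ≤ (0 : ℕ) := by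
    rw [projectiveDimension_le_iff]
    exact projective_iff_hasProjectiveDimensionLT_one.1 hproj
  have := ModuleCat.projectiveDimension_quotient_eq_add_length_of_isWeaklyRegular
    (ModuleCat.of R G) rs hG hmem
  rw [← HasProjectiveDimensionLE, ← projectiveDimension_le_iff]
  refine this.le.trans ((add_le_add_left hpd _).trans ?_)
  simp

/-- If the maximal ideal of `R ⧸ I` decomposes, then it is a direct summand of its own syzygy
over `R ⧸ I`. -/
lemma exists_surjective_isDirectSummand_ker {I : Ideal R} [Module.Finite R M]
    {inc : M →ₗ[R] R ⧸ I} (hinc : Function.Injective inc)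
    (hrange : LinearMap.range inc = Submodule.map I.mkQ (maximalIdeal R)) {A B : Submodule R M}
    (hAB : IsCompl A B) (hA : A ≠ ⊥) (hB : B ≠ ⊥) :
    ∃ (m : ℕ) (g : ((R × R × (Fin m → R)) ⧸
        (I • ⊤ : Submodule R (R × R × (Fin m → R)))) →ₗ[R] M),
      Function.Surjective g ∧ IsDirectSummand R M (LinearMap.ker g) := by
  have hmem (u : M) : ∃ r ∈ maximalIdeal R, I.mkQ r = inc u :=
    Submodule.mem_map.1 (hrange ▸ LinearMap.mem_range_self inc u)
  have hcross {A B : Submodule R M} (h : Disjoint A B) {a b : M} (ha : a ∈ A) (hb : b ∈ B)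
      {r : R} (hr : I.mkQ r = inc b) : r • a = 0 := by
    obtain ⟨s, -, hs⟩ := hmem a
    have : r • a = s • b := hinc <| by
      rw [map_smul, map_smul, ← hr, ← hs, ← map_smul, ← map_smul, smul_eq_mul, smul_eq_mul,
        mul_comm]
    exact Submodule.disjoint_def.1 h _ (A.smul_mem r ha) (this ▸ B.smul_mem s hb)
  have hann {r : R} (hr : r ∈ I) (u : M) : r • u = 0 := hinc <| by
    obtain ⟨s, -, hs⟩ := hmem u
    rw [map_zero, map_smul, ← hs, ← map_smul, Submodule.mkQ_apply, Submodule.Quotient.mk_eq_zero]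
    exact I.mul_mem_right _ hr
  have hgen {A B : Submodule R M} (h : IsCompl A B) (hA : A ≠ ⊥) :
      ∃ f : M →ₗ[R] ResidueField R, (∃ a ∈ A, f a = 1) ∧ ∀ b ∈ B, f b = 0 := by
    have := Submodule.nontrivial_iff_ne_bot.2 hA
    obtain ⟨f, a, ha⟩ := exists_apply_eq_one_residueField (R := R) A
    refine ⟨f ∘ₗ A.projectionOnto B h, ⟨a, a.2, ?_⟩, fun b hb => ?_⟩
    · simp [ha]
    · simp [(Submodule.projectionOnto_apply_eq_zero_iff h).2 hb]
  obtain ⟨fA, ⟨a, ha, hfa⟩, hfA⟩ := hgen hAB hA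
  obtain ⟨fB, ⟨b, hb, hfb⟩, hfB⟩ := hgen hAB.symm hB
  obtain ⟨m, ν, hν⟩ := Module.Finite.exists_fin' R ↥(LinearMap.ker fA ⊓ LinearMap.ker fB)
  have hνA (c) : fA (ν c) = 0 := (ν c).2.1
  have hνB (c) : fB (ν c) = 0 := (ν c).2.2
  let G := R × R × (Fin m → R)
  let J : Submodule R G := I • ⊤
  let π : G →ₗ[R] M := (LinearMap.toSpanSingleton R M a).coprod
    ((LinearMap.toSpanSingleton R M b).coprod (Submodule.subtype _ ∘ₗ ν))
  have hπ (r s c) : π (r, s, c) = r • a + (s • b + ν c) := rfl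
  let g : (G ⧸ J) →ₗ[R] M := J.liftQ π <| Submodule.smul_le.2 fun r hr x _ => by
    rw [LinearMap.mem_ker, map_smul, hann hr]
  have hg (x : G) : g (J.mkQ x) = π x := J.liftQ_apply π x
  let φ (f : G →ₗ[R] R) : (G ⧸ J) →ₗ[R] R ⧸ I := J.mapQ I f <|
    Submodule.smul_le.2 fun r hr x _ => by
      rw [Submodule.mem_comap, map_smul]
      exact I.mul_mem_right _ hr
  let ψ (c : R →ₗ[R] G) : (R ⧸ I) →ₗ[R] G ⧸ J := I.mapQ J c fun r hr => by
    rw [Submodule.mem_comap, ← mul_one r, ← smul_eq_mul, map_smul]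
    exact Submodule.smul_mem_smul hr trivial
  have hφψ (f c x) (h : f ∘ₗ c = LinearMap.id) : φ f (ψ c x) = x := by
    obtain ⟨r, rfl⟩ := I.mkQ_surjective x
    exact congrArg I.mkQ (LinearMap.congr_fun h r)
  have hφψ' (f c x) (h : f ∘ₗ c = 0) : φ f (ψ c x) = 0 := by
    obtain ⟨r, rfl⟩ := I.mkQ_surjective x
    exact (congrArg I.mkQ (LinearMap.congr_fun h r)).trans (map_zero _)
  let c₁ : R →ₗ[R] G := LinearMap.inl R R (R × (Fin m → R))
  let c₂ : R →ₗ[R] G := LinearMap.inr R R (R × (Fin m → R)) ∘ₗ LinearMap.inl R R (Fin m → R)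
  let f₁ : G →ₗ[R] R := LinearMap.fst R R (R × (Fin m → R))
  let f₂ : G →ₗ[R] R := LinearMap.fst R R (Fin m → R) ∘ₗ LinearMap.snd R R (R × (Fin m → R))
  have hsmul_one (r : R) : r • (1 : ResidueField R) = residue R r := by
    rw [Algebra.smul_def, mul_one]; rfl
  refine ⟨m, g, fun u => ?_, ?_⟩
  · obtain ⟨r, hr⟩ := residue_surjective (fA u)
    obtain ⟨s, hs⟩ := residue_surjective (fB u)
    obtain ⟨c, hc⟩ := hν ⟨u - r • a - s • b, Submodule.mem_inf.2 (by
      constructor <;> simp [hfa, hfb, hfA b hb, hfB a ha, hsmul_one, hr, hs])⟩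
    refine ⟨J.mkQ (r, s, c), ?_⟩
    rw [hg, hπ, congrArg Subtype.val hc]
    module
  have hker (q : LinearMap.ker g) : φ f₁ q ∈ LinearMap.range inc ∧ φ f₂ q ∈ LinearMap.range inc := by
    obtain ⟨q, hq⟩ := q
    obtain ⟨⟨r, s, c⟩, rfl⟩ := J.mkQ_surjective q
    rw [LinearMap.mem_ker, hg, hπ] at hq
    rw [hrange]
    refine ⟨⟨r, ?_, rfl⟩, ⟨s, ?_, rfl⟩⟩
    · simpa [hfa, hfA b hb, hνA, hsmul_one] using congrArg fA hq
    · simpa [hfb, hfB a ha, hνB, hsmul_one] using congrArg fB hq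
  obtain ⟨j₁, hj₁⟩ := LinearMap.exists_comp_eq_of_range_le hinc
    (φ f₁ ∘ₗ (LinearMap.ker g).subtype) (by rintro _ ⟨q, rfl⟩; exact (hker q).1)
  obtain ⟨j₂, hj₂⟩ := LinearMap.exists_comp_eq_of_range_le hinc
    (φ f₂ ∘ₗ (LinearMap.ker g).subtype) (by rintro _ ⟨q, rfl⟩; exact (hker q).2)
  replace hj₁ (q) : inc (j₁ q) = φ f₁ q := LinearMap.congr_fun hj₁ q
  replace hj₂ (q) : inc (j₂ q) = φ f₂ q := LinearMap.congr_fun hj₂ q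
  let pA := A.projection B hAB
  let pB := B.projection A hAB.symm
  let i₀ : M →ₗ[R] G ⧸ J := ψ c₁ ∘ₗ inc ∘ₗ pB + ψ c₂ ∘ₗ inc ∘ₗ pA
  have hi₀ (u) : i₀ u = ψ c₁ (inc (pB u)) + ψ c₂ (inc (pA u)) := rfl
  let i : M →ₗ[R] LinearMap.ker g := i₀.codRestrict _ fun u => by
    obtain ⟨r, -, hr⟩ := hmem (pB u)
    obtain ⟨s, -, hs⟩ := hmem (pA u)
    have h₁ : r • a = 0 := hcross hAB.disjoint ha (Submodule.projection_apply_mem _ u) hr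
    have h₂ : s • b = 0 := hcross hAB.symm.disjoint hb (Submodule.projection_apply_mem _ u) hs
    rw [LinearMap.mem_ker, hi₀, ← hr, ← hs, map_add]
    have e₁ : g (ψ c₁ (I.mkQ r)) = π (r, 0, 0) := rfl
    have e₂ : g (ψ c₂ (I.mkQ s)) = π (0, s, 0) := rfl
    rw [e₁, e₂, hπ, hπ, h₁, h₂]
    simp
  have hi₁ (u) : j₁ (i u) = pB u := hinc <| by
    rw [hj₁]
    change φ f₁ (i₀ u) = _
    rw [hi₀, map_add, hφψ f₁ c₁ _ rfl, hφψ' f₁ c₂ _ rfl, add_zero]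
  have hi₂ (u) : j₂ (i u) = pA u := hinc <| by
    rw [hj₂]
    change φ f₂ (i₀ u) = _
    rw [hi₀, map_add, hφψ f₂ c₂ _ rfl, hφψ' f₂ c₁ _ rfl, zero_add]
  refine ⟨i, pB ∘ₗ j₁ + pA ∘ₗ j₂, ?_⟩
  ext u
  have h₁ : pB (pB u) = pB u :=
    Submodule.projection_apply_of_mem_left _ (Submodule.projection_apply_mem _ u)
  have h₂ : pA (pA u) = pA u :=
    Submodule.projection_apply_of_mem_left _ (Submodule.projection_apply_mem _ u)
  simp only [LinearMap.add_apply, LinearMap.comp_apply, hi₁, hi₂, h₁, h₂, LinearMap.id_apply]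
  exact Submodule.projection_add_projection_eq_self hAB.symm u

/-- If the maximal ideal decomposes modulo a regular sequence of length `n`, then
`Ω^(n+1) k` is a stable summand of `Ω^(n+2) k`. -/
lemma MinFreeRes.isStableSummand_syz (F : MinFreeRes R (maximalIdeal R) (ResidueField R))
    {rs : List R} (hrs : IsWeaklyRegular R rs) (hmem : ∀ r ∈ rs, r ∈ maximalIdeal R)
    {A B : Submodule R (↥(maximalIdeal R) ⧸
      Submodule.comap (maximalIdeal R).subtype (Ideal.ofList rs))}
    (hAB : IsCompl A B) (hA : A ≠ ⊥) (hB : B ≠ ⊥) :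
    IsStableSummand R (F.Syz (rs.length + 1)) (F.Syz (rs.length + 2)) := by
  let I := Ideal.ofList rs
  have hI : I ≤ maximalIdeal R := Ideal.span_le.2 hmem
  let J := Submodule.comap (maximalIdeal R).subtype I
  let inc : (↥(maximalIdeal R) ⧸ J) →ₗ[R] R ⧸ I := J.mapQ I (maximalIdeal R).subtype le_rfl
  have hinc : Function.Injective inc := by
    rw [← LinearMap.ker_eq_bot]
    exact (Submodule.ker_mapQ ..).trans (Submodule.mkQ_map_self J)
  have hrange : LinearMap.range inc = Submodule.map I.mkQ (maximalIdeal R) := by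
    rw [Submodule.range_mapQ, Submodule.range_subtype]
  let p : (R ⧸ I) →ₗ[R] ResidueField R := Submodule.factor hI
  have hp : Function.Surjective p := Submodule.factor_surjective hI
  have hincp : LinearMap.range inc = LinearMap.ker p := by
    have : LinearMap.ker p = Submodule.map I.mkQ (LinearMap.ker (maximalIdeal R).mkQ) :=
      Submodule.ker_liftQ I _ _
    rw [hrange, this, Submodule.ker_mkQ]
  obtain ⟨m, g, hg, hker⟩ := exists_surjective_isDirectSummand_ker hinc hrange hAB hA hB
  have hpd := hasProjectiveDimensionLT_quotient_ofList_smul_top hrs hmem R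
  rw [show I • (⊤ : Submodule R R) = I from Ideal.mul_top I] at hpd
  have hpd' := hasProjectiveDimensionLT_quotient_ofList_smul_top hrs hmem (R × R × (Fin m → R))
  obtain ⟨K, _, _, hK⟩ := exists_isNthSyzygy R rs.length (↥(maximalIdeal R) ⧸ J)
  obtain ⟨K', _, _, hK'⟩ := exists_isSyzygy R K
  obtain ⟨L, _, _, hL⟩ := exists_isNthSyzygy R rs.length (LinearMap.ker g)
  have h₁ := IsNthSyzygy.isStableSummand_of_exact inc p hinc hp hincp hpd hK
    (F.isNthSyzygy_syz (rs.length + 1))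
  have h₂ := hK.isStableSummand hL hker.isStableSummand
  have h₃ := IsNthSyzygy.isStableSummand_of_exact (LinearMap.ker g).subtype g
    Subtype.val_injective hg (Submodule.range_subtype _) hpd' hL (hK.succ hK')
  have h₄ := hK'.isStableSummand (F.isSyzygy_syz (rs.length + 1)) h₁.1
  exact ((h₁.2.trans h₂).trans h₃.1).trans h₄

end LocalRing

/-- if the maximal ideal `𝔪` is quasi-decomposable and `t = depth R`,
then `Ω^{t+1}(k)` is a direct summand of `Ω^{t+2}(k)`. -/
theorem stmt14 (R : Type u) [CommRing R] [IsNoetherianRing R] [IsLocalRing R]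
    (t : ℕ) (ht : HasDepth R (IsLocalRing.maximalIdeal R) R t)
    (hqd : ∃ rs : List R, (∀ x ∈ rs, x ∈ IsLocalRing.maximalIdeal R) ∧
      RingTheory.Sequence.IsRegular R rs ∧
      ∃ A B : Submodule R
        (↥(IsLocalRing.maximalIdeal R) ⧸
          Submodule.comap (IsLocalRing.maximalIdeal R).subtype (Ideal.ofList rs)),
        A ≠ ⊥ ∧ B ≠ ⊥ ∧ A ⊓ B = ⊥ ∧ A ⊔ B = ⊤) :
    ∀ F : MinFreeRes R (IsLocalRing.maximalIdeal R) (IsLocalRing.ResidueField R),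
      IsDirectSummand R (F.Syz (t + 1)) (F.Syz (t + 2)) := by
  intro F
  obtain ⟨rs, hmem, hreg, A, B, hA, hB, hAB, hAB'⟩ := hqd
  have hlen : rs.length ≤ t := ht.2 rs hmem hreg
  have hstable := F.isStableSummand_syz hreg.toIsWeaklyRegular hmem
    (isCompl_iff.2 ⟨disjoint_iff.2 hAB, codisjoint_iff.2 hAB'⟩) hA hB
  have h : IsStableSummand R (F.Syz (t + 1)) (F.Syz (t + 2)) :=
    Nat.le_induction hstable (fun n _ ih =>
      (F.isSyzygy_syz (n + 1)).isStableSummand (F.isSyzygy_syz (n + 2)) ih) t hlen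
  have : Module.Finite R (F.Syz (t + 1)) :=
    inferInstanceAs (Module.Finite R (LinearMap.range (F.d t)))
  exact h.isDirectSummand (F.apply_mem_maximalIdeal ht)
end

section
/- Let (R, m, k) be a commutative noetherian local ring of positive dimension d. Suppose there exist an R-regular sequence x₁,…,x_{d−1}, a regular local ring S of dimension two, and a regular system of parameters y, z of S such that R/(x₁,…,x_{d−1}) ≅ S/(yz). Then R is a hypersurface (edim R − depth R ≤ 1) with minimal multiplicity, i.e., e(R) = edim R − dim R + 1. -/
universe u

section

open RingTheory.Sequence

section
variable {R : Type*} [CommRing R]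

open scoped Pointwise in
theorem isWeaklyRegular_quotient_cons_iff (J : Ideal R) (x : R) (l : List R) :
    IsWeaklyRegular (R ⧸ J) (x :: l) ↔
      (∀ a, x * a ∈ J → a ∈ J) ∧ IsWeaklyRegular (R ⧸ (J ⊔ Ideal.span {x})) l := by
  have hsub : (x • (⊤ : Submodule R (R ⧸ J))) =
      Submodule.map J.mkQ (Ideal.span {x}) := by
    ext b
    constructor
    · rintro ⟨b, -, rfl⟩
      obtain ⟨b, rfl⟩ := Ideal.Quotient.mk_surjective b
      exact ⟨x * b, Ideal.mul_mem_right _ _ (Ideal.mem_span_singleton_self x), rfl⟩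
    · rintro ⟨b, hb, rfl⟩
      obtain ⟨c, rfl⟩ := Ideal.mem_span_singleton'.mp hb
      exact ⟨Ideal.Quotient.mk J c, trivial, by rw [mul_comm]; rfl⟩
  have e : QuotSMulTop x (R ⧸ J) ≃ₗ[R] R ⧸ (J ⊔ Ideal.span {x}) :=
    (Submodule.quotEquivOfEq _ _ hsub).trans
      (Submodule.quotientQuotientEquivQuotientSup J (Ideal.span {x}))
  rw [isWeaklyRegular_cons_iff, e.isWeaklyRegular_congr]
  refine and_congr_left fun _ => ?_
  exact isSMulRegular_quotient_iff_mem_of_smul_mem _ _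

theorem isWeaklyRegular_quotient_concat_iff (l : List R) (x : R) (J : Ideal R) :
    IsWeaklyRegular (R ⧸ J) (l ++ [x]) ↔ IsWeaklyRegular (R ⧸ J) l ∧
      ∀ a, x * a ∈ J ⊔ Ideal.ofList l → a ∈ J ⊔ Ideal.ofList l := by
  induction l generalizing J with
  | nil =>
    simp [IsWeaklyRegular.nil, isSMulRegular_quotient_iff_mem_of_smul_mem]
  | cons y l ih =>
    rw [List.cons_append, isWeaklyRegular_quotient_cons_iff, ih,
      isWeaklyRegular_quotient_cons_iff, Ideal.ofList_cons, sup_assoc, and_assoc]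

theorem Ideal.sup_span_singleton_pow_succ_le (q : Ideal R) (x : R) (n : ℕ) :
    (q ⊔ Ideal.span {x}) ^ (n + 1) ≤
      q ^ (n + 1) ⊔ Ideal.span {x} * (q ⊔ Ideal.span {x}) ^ n := by
  induction n with
  | zero => simp
  | succ n ih =>
    have h : q * (q ⊔ Ideal.span {x}) ^ (n + 1) ≤
        q ^ (n + 2) ⊔ Ideal.span {x} * (q ⊔ Ideal.span {x}) ^ (n + 1) := by
      refine (Ideal.mul_mono_right ih).trans ?_
      rw [Ideal.mul_sup, ← pow_succ']
      refine sup_le_sup_left ?_ _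
      rw [mul_left_comm, pow_succ' _ n]
      exact Ideal.mul_mono_right (Ideal.mul_mono_left le_sup_left)
    rw [pow_succ' _ (n + 1), Ideal.sup_mul]
    exact sup_le h le_sup_right

theorem Ideal.mem_sup_mul_pow_of_mul_mem {J A q : Ideal R} {x : R} {n : ℕ} (hA : q ≤ A)
    (hx : ∀ a, x * a ∈ J ⊔ q ^ (n + 1) → a ∈ J ⊔ q ^ (n + 1)) {a : R}
    (ha : x * a ∈ J ⊔ A * (q ⊔ Ideal.span {x}) ^ (n + 1)) :
    a ∈ J ⊔ A * (q ⊔ Ideal.span {x}) ^ n := by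
  have hle : J ⊔ A * (q ⊔ Ideal.span {x}) ^ (n + 1) ≤
      (J ⊔ q ^ (n + 1)) ⊔ Ideal.span {x} * (A * (q ⊔ Ideal.span {x}) ^ n) := by
    rw [sup_assoc]
    refine sup_le_sup_left ?_ _
    refine (Ideal.mul_mono_right (Ideal.sup_span_singleton_pow_succ_le q x n)).trans ?_
    rw [Ideal.mul_sup, mul_left_comm]
    exact sup_le_sup_right Ideal.mul_le_right _
  obtain ⟨u, hu, v, hv, huv⟩ := Submodule.mem_sup.mp (hle ha)
  obtain ⟨b, hb, rfl⟩ := Ideal.mem_span_singleton_mul.mp hv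
  have hab : a - b ∈ J ⊔ q ^ (n + 1) := hx _ (by
    rw [mul_sub, ← huv, add_sub_cancel_right]; exact hu)
  have hle' : J ⊔ q ^ (n + 1) ≤ J ⊔ A * (q ⊔ Ideal.span {x}) ^ n := by
    rw [pow_succ']
    exact sup_le_sup_left (Ideal.mul_mono hA (Ideal.pow_right_mono le_sup_left n)) _
  have := add_mem (hle' hab) (Ideal.mem_sup_right (S := J) hb)
  rwa [sub_add_cancel] at this

variable [IsNoetherianRing R] [IsLocalRing R]

theorem isWeaklyRegular_quotient_cons_rotate {J : Ideal R} {x : R} {l : List R}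
    (hl : ∀ r ∈ x :: l, r ∈ IsLocalRing.maximalIdeal R)
    (h : IsWeaklyRegular (R ⧸ J) (x :: l)) :
    IsWeaklyRegular (R ⧸ J) l ∧
      ∀ a, x * a ∈ J ⊔ Ideal.ofList l → a ∈ J ⊔ Ideal.ofList l := by
  rw [← isWeaklyRegular_quotient_concat_iff]
  exact IsLocalRing.isWeaklyRegular_of_perm_of_subset_maximalIdeal h
    (List.perm_append_singleton x l).symm hl

theorem mem_sup_ofList_pow_of_mul_mem (l : List R) (J : Ideal R)
    (hl : ∀ r ∈ l, r ∈ IsLocalRing.maximalIdeal R) (h : IsWeaklyRegular (R ⧸ J) l) {x : R}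
    (hx : ∀ a, x * a ∈ J ⊔ Ideal.ofList l → a ∈ J ⊔ Ideal.ofList l) (n : ℕ) (a : R)
    (ha : x * a ∈ J ⊔ Ideal.ofList l ^ n) : a ∈ J ⊔ Ideal.ofList l ^ n := by
  induction l generalizing J n a x with
  | nil =>
    cases n with
    | zero => simp
    | succ n => simpa using hx a (by simpa using ha)
  | cons y l ih =>
    have hl' : ∀ r ∈ l, r ∈ IsLocalRing.maximalIdeal R := fun r hr => hl r (.tail _ hr)
    obtain ⟨h₁, h₂⟩ := isWeaklyRegular_quotient_cons_rotate hl h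
    have h₃ := ((isWeaklyRegular_quotient_cons_iff J y l).mp h).2
    rw [Ideal.ofList_cons, sup_comm (Ideal.span {y})] at hx ha ⊢
    have hle (n : ℕ) : J ⊔ (Ideal.ofList l ⊔ Ideal.span {y}) ^ (n + 1) ≤
        (J ⊔ Ideal.span {y}) ⊔ Ideal.ofList l ^ (n + 1) := by
      refine sup_le (le_sup_left.trans le_sup_left) ?_
      refine (Ideal.sup_span_singleton_pow_succ_le _ y n).trans
        (sup_le le_sup_right (Ideal.mul_le_left.trans (le_sup_right.trans le_sup_left)))
    induction n generalizing a with
    | zero => simp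
    | succ n ihn =>
      have hxJ : ∀ a, x * a ∈ (J ⊔ Ideal.span {y}) ⊔ Ideal.ofList l →
          a ∈ (J ⊔ Ideal.span {y}) ⊔ Ideal.ofList l := by
        rwa [sup_assoc, sup_comm (Ideal.span {y})]
      have ha' := ih _ hl' h₃ hxJ (n + 1) a (hle n ha)
      rw [sup_right_comm] at ha'
      obtain ⟨b, hb, v, hv, rfl⟩ := Submodule.mem_sup.mp ha'
      obtain ⟨c, rfl⟩ := Ideal.mem_span_singleton'.mp hv
      have hb' : b ∈ J ⊔ (Ideal.ofList l ⊔ Ideal.span {y}) ^ (n + 1) := by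
        have hle' : J ⊔ Ideal.ofList l ^ (n + 1) ≤
            J ⊔ (Ideal.ofList l ⊔ Ideal.span {y}) ^ (n + 1) :=
          sup_le_sup_left (Ideal.pow_right_mono le_sup_left _) _
        exact hle' hb
      refine add_mem hb' ?_
      have hc : y * (x * c) ∈ J ⊔ ⊤ * (Ideal.ofList l ⊔ Ideal.span {y}) ^ (n + 1) := by
        rw [Ideal.top_mul]
        have := sub_mem ha (Ideal.mul_mem_left _ x hb')
        convert this using 1
        ring
      have hc' := Ideal.mem_sup_mul_pow_of_mul_mem le_top
        (ih J hl' h₁ h₂ (n + 1)) hc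
      rw [Ideal.top_mul] at hc'
      obtain ⟨u, hu, w, hw, rfl⟩ := Submodule.mem_sup.mp (ihn c hc')
      rw [add_mul]
      refine add_mem (Ideal.mem_sup_left (Ideal.mul_mem_right _ _ hu)) (Ideal.mem_sup_right ?_)
      rw [pow_succ]
      exact Ideal.mul_mem_mul hw (Ideal.mem_sup_right (Ideal.mem_span_singleton_self y))

end

theorem Ideal.length_quotient_eq_add {R : Type*} [CommRing R] {I K : Ideal R} {x : R}
    (hK : ∀ a, a ∈ K ↔ x * a ∈ I) :
    Module.length R (R ⧸ I) =
      Module.length R (R ⧸ K) + Module.length R (R ⧸ (I ⊔ Ideal.span {x})) := by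
  have hKI : K = Submodule.comap (LinearMap.mulLeft R x) I := by
    ext a; exact hK a
  refine Module.length_eq_add_of_exact (Submodule.mapQ K I (LinearMap.mulLeft R x) hKI.le)
    (Submodule.factor le_sup_left) ?_ (Submodule.factor_surjective _) ?_
  · rw [← LinearMap.ker_eq_bot, Submodule.ker_mapQ, ← hKI, Submodule.mkQ_map_self]
  · rw [LinearMap.exact_iff, Submodule.range_mapQ]
    ext b
    obtain ⟨b, rfl⟩ := Submodule.mkQ_surjective _ b
    rw [LinearMap.mem_ker, Submodule.factor_mk, Submodule.mkQ_apply,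
      Submodule.Quotient.mk_eq_zero, Submodule.mem_sup]
    constructor
    · rintro ⟨i, hi, v, hv, rfl⟩
      obtain ⟨c, rfl⟩ := Ideal.mem_span_singleton'.mp hv
      refine ⟨x * c, ⟨c, rfl⟩, ?_⟩
      rw [Submodule.mkQ_apply, Submodule.mkQ_apply, Submodule.Quotient.eq]
      convert neg_mem hi using 1
      ring
    · rintro ⟨-, ⟨c, rfl⟩, h⟩
      rw [Submodule.mkQ_apply, Submodule.mkQ_apply, Submodule.Quotient.eq, LinearMap.mulLeft_apply] at h
      exact ⟨b - x * c, by simpa using neg_mem h, x * c,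
        Ideal.mul_mem_right _ _ (Ideal.mem_span_singleton_self x), by ring⟩

theorem Ideal.ofList_le {R : Type*} [CommRing R] {l : List R} {I : Ideal R}
    (h : ∀ r ∈ l, r ∈ I) : Ideal.ofList l ≤ I :=
  Ideal.span_le.mpr h

theorem IsLocalRing.length_quotient_maximalIdeal (R : Type*) [CommRing R] [IsLocalRing R] :
    Module.length R (R ⧸ IsLocalRing.maximalIdeal R) = 1 :=
  Module.length_eq_one_iff.mpr (isSimpleModule_iff_isCoatom.mpr
    (IsLocalRing.maximalIdeal.isMaximal R).out)

section
variable {R : Type*} [CommRing R] [IsLocalRing R]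

open IsLocalRing

theorem length_quotient_maximalIdeal_mul_ofList_pow [IsNoetherianRing R] (l : List R)
    (J : Ideal R) (hJ : J ≤ maximalIdeal R) (hl : ∀ r ∈ l, r ∈ maximalIdeal R)
    (h : IsWeaklyRegular (R ⧸ J) l) (c : ℕ)
    (hc : Module.length R (R ⧸ (J ⊔ Ideal.ofList l)) = (1 + c : ℕ)) (n : ℕ) :
    Module.length R (R ⧸ (J ⊔ maximalIdeal R * Ideal.ofList l ^ (n + 1))) =
      ((n + 1 + l.length).choose l.length + c * (n + l.length).choose l.length : ℕ) := by
  induction l generalizing J n with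
  | nil =>
    have : maximalIdeal R * Ideal.ofList [] ^ (n + 1) = Ideal.ofList [] := by simp
    rw [this, hc]
    simp
  | cons x l ih =>
    have hl' : ∀ r ∈ l, r ∈ maximalIdeal R := fun r hr => hl r (.tail _ hr)
    have hx : x ∈ maximalIdeal R := hl x (.head _)
    have hxl : Ideal.span {x} ≤ maximalIdeal R := (Ideal.span_singleton_le_iff_mem _).mpr hx
    obtain ⟨h₁, h₂⟩ := isWeaklyRegular_quotient_cons_rotate hl h
    have h₃ := ((isWeaklyRegular_quotient_cons_iff J x l).mp h).2
    rw [Ideal.ofList_cons] at hc ⊢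
    have key (n : ℕ) := ih (J ⊔ Ideal.span {x}) (sup_le hJ hxl) hl' h₃
      (by rw [sup_assoc]; exact hc) n
    rw [sup_comm (Ideal.span {x})]
    have hcol (n : ℕ) (a : R) :
        a ∈ J ⊔ maximalIdeal R * (Ideal.ofList l ⊔ Ideal.span {x}) ^ n ↔
          x * a ∈ J ⊔ maximalIdeal R * (Ideal.ofList l ⊔ Ideal.span {x}) ^ (n + 1) := by
      refine ⟨fun ha => ?_, Ideal.mem_sup_mul_pow_of_mul_mem (Ideal.ofList_le hl')
        (mem_sup_ofList_pow_of_mul_mem l J hl' h₁ h₂ (n + 1))⟩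
      obtain ⟨u, hu, v, hv, rfl⟩ := Submodule.mem_sup.mp ha
      rw [mul_add]
      refine add_mem (Ideal.mem_sup_left (Ideal.mul_mem_left _ _ hu)) (Ideal.mem_sup_right ?_)
      rw [pow_succ, ← mul_assoc, mul_comm x]
      exact Ideal.mul_mem_mul hv (Ideal.mem_sup_right (Ideal.mem_span_singleton_self x))
    have hsup (n : ℕ) :
        J ⊔ maximalIdeal R * (Ideal.ofList l ⊔ Ideal.span {x}) ^ (n + 1) ⊔ Ideal.span {x} =
          J ⊔ Ideal.span {x} ⊔ maximalIdeal R * Ideal.ofList l ^ (n + 1) := by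
      rw [sup_right_comm]
      refine le_antisymm (sup_le le_sup_left ?_)
        (sup_le_sup_left (Ideal.mul_mono_right (Ideal.pow_right_mono le_sup_left _)) _)
      refine (Ideal.mul_mono_right (Ideal.sup_span_singleton_pow_succ_le _ x n)).trans ?_
      rw [Ideal.mul_sup, mul_left_comm]
      exact sup_le le_sup_right (Ideal.mul_le_left.trans (le_sup_right.trans le_sup_left))
    have hrec (n : ℕ) := Ideal.length_quotient_eq_add (hcol n)
    induction n with
    | zero =>
      rw [hrec, hsup, key, pow_zero, mul_one, sup_eq_right.mpr hJ,
        length_quotient_maximalIdeal]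
      simp only [List.length_cons]
      norm_cast
      rw [show 0 + 1 + (l.length + 1) = l.length + 1 + 1 by ring,
        show 0 + 1 + l.length = l.length + 1 by ring]
      simp only [zero_add, Nat.choose_self, Nat.choose_succ_self_right]
      ring
    | succ n ihn =>
      rw [hrec, hsup, key, ihn]
      simp only [List.length_cons]
      norm_cast
      rw [show n + 1 + 1 + (l.length + 1) = n + l.length + 1 + 1 + 1 by ring,
        show n + 1 + (l.length + 1) = n + l.length + 1 + 1 by ring,
        show n + (l.length + 1) = n + l.length + 1 by ring,
        show n + 1 + 1 + l.length = n + l.length + 1 + 1 by ring,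
        show n + 1 + l.length = n + l.length + 1 by ring,
        Nat.choose_succ_succ' (n + l.length + 1 + 1),
        Nat.choose_succ_succ' (n + l.length + 1)]
      ring

theorem length_quotient_le_card_add (I : Ideal R) (s : Finset R)
    (hI : maximalIdeal R ^ 2 ≤ I) (hs : ∀ x ∈ s, x ∈ maximalIdeal R) :
    Module.length R (R ⧸ I) ≤
      s.card + Module.length R (R ⧸ (I ⊔ Ideal.span (s : Set R))) := by
  classical
  induction s using Finset.induction_on generalizing I with
  | empty =>
    rw [Finset.coe_empty, Ideal.span_empty, sup_bot_eq]
    exact le_add_self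
  | insert x s hx ih =>
    let K : Ideal R := Submodule.comap (LinearMap.mulLeft R x) I
    have hK : maximalIdeal R ≤ K := fun a ha => hI (by
      rw [pow_two]
      exact Ideal.mul_mem_mul (hs x (Finset.mem_insert_self x s)) ha)
    have hK' : Module.length R (R ⧸ K) ≤ 1 := by
      rw [← length_quotient_maximalIdeal R]
      exact Module.length_le_of_surjective (Submodule.factor hK) (Submodule.factor_surjective _)
    rw [Ideal.length_quotient_eq_add (K := K) (x := x) fun _ => Iff.rfl]
    have := ih (I ⊔ Ideal.span {x}) (hI.trans le_sup_left)
      fun y hy => hs y (Finset.mem_insert_of_mem hy)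
    rw [sup_assoc, ← Ideal.span_union, Set.singleton_union, ← Finset.coe_insert] at this
    rw [Finset.card_insert_of_notMem hx, Nat.cast_succ, add_comm (s.card : ℕ∞), add_assoc]
    exact add_le_add hK' this

theorem length_quotient_maximalIdeal_sq_le (s : Finset R)
    (hs : Ideal.span (s : Set R) = maximalIdeal R) :
    Module.length R (R ⧸ maximalIdeal R ^ 2) ≤ (s.card + 1 : ℕ) := by
  have := length_quotient_le_card_add (maximalIdeal R ^ 2) s le_rfl
    fun x hx => hs ▸ Ideal.subset_span hx
  rwa [hs, sup_eq_right.mpr (Ideal.pow_le_self two_ne_zero),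
    length_quotient_maximalIdeal] at this

end

theorem exists_perm_cons_of_mem_ofList {R : Type*} [CommRing R] [IsLocalRing R] (l : List R)
    {a : R} (ha : a ∈ Ideal.ofList l) :
    a ∈ IsLocalRing.maximalIdeal R * Ideal.ofList l ∨
      ∃ (x : R) (l' : List R), l.Perm (x :: l') ∧ x ∈ Ideal.span {a} ⊔ Ideal.ofList l' := by
  induction l generalizing a with
  | nil => left; simpa using ha
  | cons r l ih =>
    rw [Ideal.ofList_cons] at ha ⊢
    obtain ⟨c, b, hb, rfl⟩ := Ideal.mem_span_singleton_sup.mp ha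
    by_cases hc : IsUnit c
    · right
      obtain ⟨c, rfl⟩ := hc
      refine ⟨r, l, .refl _, ?_⟩
      exact Ideal.mem_span_singleton_sup.mpr
        ⟨↑c⁻¹, -(↑c⁻¹ * b), neg_mem (Ideal.mul_mem_left _ _ hb), by simp [mul_add]⟩
    · rcases ih hb with hb | ⟨x, l', hl, hx⟩
      · left
        refine add_mem (Ideal.mul_mem_mul hc
          (Ideal.mem_sup_left (Ideal.mem_span_singleton_self r))) ?_
        exact Ideal.mul_mono_right le_sup_right hb
      · right
        refine ⟨x, r :: l', (hl.cons r).trans (.swap x r l'), ?_⟩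
        obtain ⟨e, f, hf, rfl⟩ := Ideal.mem_span_singleton_sup.mp hx
        rw [Ideal.ofList_cons]
        have : e * b + f = e * (c * r + b) + (-(e * c) * r + f) := by ring
        rw [this]
        exact add_mem
          (Ideal.mem_sup_left (Ideal.mul_mem_left _ _ (Ideal.mem_span_singleton_self _)))
          (Ideal.mem_sup_right (add_mem (Ideal.mem_sup_left
            (Ideal.mul_mem_left _ _ (Ideal.mem_span_singleton_self _)))
            (Ideal.mem_sup_right hf)))

section
variable {S : Type*} [CommRing S] [IsNoetherianRing S] [IsLocalRing S] {y z : S}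

open IsLocalRing

theorem mem_span_singleton_of_mul_mem (hS : ringKrullDim S = 2)
    (hyz : Ideal.span {y, z} = maximalIdeal S) {a : S} (ha : z * a ∈ Ideal.span {y}) :
    a ∈ Ideal.span {y} := by
  have hy : y ∈ maximalIdeal S := hyz ▸ Ideal.subset_span (by simp)
  have hz : z ∈ maximalIdeal S := hyz ▸ Ideal.subset_span (by simp)
  have hyz' : maximalIdeal S = Ideal.span {y} ⊔ Ideal.span {z} := by
    rw [← hyz, Ideal.span_insert]
  have hpow (n : ℕ) : z ^ n ∉ Ideal.span {y} := by
    intro hn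
    have hmin : maximalIdeal S ∈ (Ideal.span {y}).minimalPrimes := by
      refine ⟨⟨inferInstance, (Ideal.span_singleton_le_iff_mem _).mpr hy⟩, ?_⟩
      rintro p ⟨hp, hyp⟩ -
      rw [hyz']
      exact sup_le hyp ((Ideal.span_singleton_le_iff_mem _).mpr (hp.mem_of_pow_mem n (hyp hn)))
    have hle := Ideal.height_le_one_of_isPrincipal_of_mem_minimalPrimes _ _ hmin
    have hdim := maximalIdeal_height_eq_ringKrullDim (R := S)
    rw [hS] at hdim
    have : (maximalIdeal S).height = 2 := by rw [← WithBot.coe_inj, hdim]; rfl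
    rw [this] at hle
    exact absurd hle (by decide)
  by_contra hna
  have key (n : ℕ) : a ∈ Ideal.span {y} ⊔ Ideal.span {z ^ n} := by
    induction n with
    | zero => simp
    | succ n ih =>
      obtain ⟨b, hb, v, hv, rfl⟩ := Submodule.mem_sup.mp ih
      obtain ⟨u, rfl⟩ := Ideal.mem_span_singleton'.mp hv
      refine add_mem (Ideal.mem_sup_left hb) ?_
      have hu : u ∈ maximalIdeal S := by
        intro hu
        refine hpow (n + 1) ?_
        have h := sub_mem ha (Ideal.mul_mem_left _ z hb)
        rw [← hu.unit_spec] at h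
        rw [← (Ideal.span {y}).unit_mul_mem_iff_mem hu.unit.isUnit]
        convert h using 1
        ring
      rw [hyz'] at hu
      obtain ⟨s, hs, w, hw, rfl⟩ := Submodule.mem_sup.mp hu
      obtain ⟨t, rfl⟩ := Ideal.mem_span_singleton'.mp hw
      rw [add_mul]
      refine add_mem (Ideal.mem_sup_left (Ideal.mul_mem_right _ _ hs)) (Ideal.mem_sup_right ?_)
      exact Ideal.mem_span_singleton'.mpr ⟨t, by ring⟩
  have hbot := Ideal.iInf_pow_smul_eq_bot_of_isLocalRing (M := S ⧸ Ideal.span {y})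
    (maximalIdeal S) (maximalIdeal.isMaximal S).ne_top
  refine hna (Ideal.Quotient.eq_zero_iff_mem.mp ?_)
  rw [← Submodule.mem_bot S, ← hbot, Submodule.mem_iInf]
  intro n
  obtain ⟨b, hb, v, hv, rfl⟩ := Submodule.mem_sup.mp (key n)
  obtain ⟨u, rfl⟩ := Ideal.mem_span_singleton'.mp hv
  rw [map_add, Ideal.Quotient.eq_zero_iff_mem.mpr hb, zero_add, mul_comm, map_mul]
  exact Submodule.smul_mem_smul (Ideal.pow_mem_pow hz n) (Submodule.mem_top (x := Ideal.Quotient.mk _ u))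

theorem mem_span_mul_of_add_mul_mem (hS : ringKrullDim S = 2)
    (hyz : Ideal.span {y, z} = maximalIdeal S) {a : S}
    (ha : (y + z) * a ∈ Ideal.span {y * z}) : a ∈ Ideal.span {y * z} := by
  have hzy : Ideal.span {z, y} = maximalIdeal S := by rw [Set.pair_comm, hyz]
  obtain ⟨t, ht⟩ := Ideal.mem_span_singleton'.mp ha
  obtain ⟨b, rfl⟩ := Ideal.mem_span_singleton'.mp <| mem_span_singleton_of_mul_mem hS hyz
    (a := a) (Ideal.mem_span_singleton'.mpr ⟨t * z - a, by linear_combination ht⟩)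
  have hb := mem_span_singleton_of_mul_mem hS hzy
    (a := b * y) (Ideal.mem_span_singleton'.mpr ⟨t * y - b * y, by linear_combination ht⟩)
  rw [mul_comm b] at hb
  obtain ⟨c, rfl⟩ := Ideal.mem_span_singleton'.mp (mem_span_singleton_of_mul_mem hS hzy hb)
  exact Ideal.mem_span_singleton'.mpr ⟨c, by ring⟩

theorem notMem_span_add_mul (hS : ringKrullDim S = 2)
    (hyz : Ideal.span {y, z} = maximalIdeal S) (a b : S) :
    y ≠ a * (y + z) + b * (y * z) := by
  intro h
  have hzy : Ideal.span {z, y} = maximalIdeal S := by rw [Set.pair_comm, hyz]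
  have h₁ : a ∈ Ideal.span {y} := mem_span_singleton_of_mul_mem hS hyz
    (Ideal.mem_span_singleton'.mpr ⟨1 - a - b * z, by linear_combination h⟩)
  have h₂ : 1 - a ∈ Ideal.span {z} := mem_span_singleton_of_mul_mem hS hzy
    (Ideal.mem_span_singleton'.mpr ⟨a + b * y, by linear_combination -h⟩)
  have hle : Ideal.span {y} ⊔ Ideal.span {z} = maximalIdeal S := by
    rw [← hyz, Ideal.span_insert y {z}]
  have h1 : (1 : S) ∈ maximalIdeal S := by
    rw [← hle]
    simpa using add_mem (Ideal.mem_sup_left (T := Ideal.span {z}) h₁) (Ideal.mem_sup_right h₂)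
  exact h1 isUnit_one

end

section
variable {R : Type*} [CommRing R] [IsLocalRing R]

open IsLocalRing

theorem exists_lift_of_quotient_equiv {S : Type*} [CommRing S] [IsNoetherianRing S]
    [IsLocalRing S] {y z : S} (hS : ringKrullDim S = 2)
    (hyz : Ideal.span {y, z} = maximalIdeal S) (I : Ideal R)
    (iso : (R ⧸ I) ≃+* (S ⧸ Ideal.span {y * z})) :
    ∃ y' z' : R, maximalIdeal R = I ⊔ Ideal.span {y', z'} ∧ y' * z' ∈ I ∧
      (∀ a, (y' + z') * a ∈ I → a ∈ I) ∧
      (∀ a, z' * a ∈ I ⊔ Ideal.span {y'} → a ∈ I ⊔ Ideal.span {y'}) ∧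
      y' ∉ I ⊔ Ideal.span {y' + z'} := by
  have hy : y ∈ maximalIdeal S := hyz ▸ Ideal.subset_span (by simp)
  have hz : z ∈ maximalIdeal S := hyz ▸ Ideal.subset_span (by simp)
  let φ : R →+* S ⧸ Ideal.span {y * z} := iso.toRingHom.comp (Ideal.Quotient.mk I)
  let π : S →+* S ⧸ Ideal.span {y * z} := Ideal.Quotient.mk _
  have hφ (a : R) : φ a = 0 ↔ a ∈ I := by
    simp [φ, Ideal.Quotient.eq_zero_iff_mem]
  have hπ (s : S) : π s = 0 ↔ s ∈ Ideal.span {y * z} := Ideal.Quotient.eq_zero_iff_mem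
  have hlift (s : S) : ∃ a, φ a = π s :=
    (iso.surjective.comp Ideal.Quotient.mk_surjective) (π s)
  have hlift' (a : R) : ∃ s, π s = φ a := Ideal.Quotient.mk_surjective _
  have hle : Ideal.span {y * z} ≤ Ideal.span {y} :=
    Ideal.span_singleton_le_span_singleton.mpr (dvd_mul_right y z)
  have hley : Ideal.span {y} ≤ maximalIdeal S := (Ideal.span_singleton_le_iff_mem _).mpr hy
  have hunit (a : R) (s : S) (h : π s = φ a) (hs : s ∈ maximalIdeal S) :
      a ∈ maximalIdeal R := by
    intro ha
    obtain ⟨t, ht⟩ := hlift' ↑ha.unit⁻¹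
    have : π (s * t - 1) = 0 := by
      rw [map_sub, map_mul, h, ht, ← map_mul, IsUnit.mul_val_inv, map_one, map_one, sub_self]
    have h1 := sub_mem (Ideal.mul_mem_right t _ hs) (hley (hle ((hπ _).mp this)))
    rw [sub_sub_cancel] at h1
    exact h1 isUnit_one
  have hIm : I ≤ maximalIdeal R := fun a ha =>
    hunit a 0 (by rw [map_zero, (hφ a).mpr ha]) (zero_mem _)
  obtain ⟨y', hy'⟩ := hlift y
  obtain ⟨z', hz'⟩ := hlift z
  have hmem (a : R) (s : S) (h : π s = φ a) :
      a ∈ I ⊔ Ideal.span {y'} ↔ s ∈ Ideal.span {y} := by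
    constructor
    · intro ha
      obtain ⟨b, hb, v, hv, rfl⟩ := Submodule.mem_sup.mp ha
      obtain ⟨u, rfl⟩ := Ideal.mem_span_singleton'.mp hv
      obtain ⟨t, ht⟩ := hlift' u
      have : π (s - t * y) = 0 := by
        rw [map_sub, map_mul, h, ht, map_add, map_mul, hy', (hφ b).mpr hb, zero_add, sub_self]
      have := add_mem (hle ((hπ _).mp this))
        (Ideal.mul_mem_left _ t (Ideal.mem_span_singleton_self y))
      rwa [sub_add_cancel] at this
    · intro hs
      obtain ⟨t, rfl⟩ := Ideal.mem_span_singleton'.mp hs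
      obtain ⟨u, hu⟩ := hlift t
      have : φ (a - u * y') = 0 := by
        rw [map_sub, map_mul, ← h, hu, hy', map_mul, sub_self]
      have := add_mem (Ideal.mem_sup_left ((hφ _).mp this))
        (Ideal.mem_sup_right (S := I)
          (Ideal.mul_mem_left _ u (Ideal.mem_span_singleton_self y')))
      rwa [sub_add_cancel] at this
  refine ⟨y', z', le_antisymm ?_ (sup_le hIm ?_), ?_, ?_, ?_, ?_⟩
  · intro a ha
    obtain ⟨s, hs⟩ := hlift' a
    have hsm : s ∈ maximalIdeal S := by
      intro hsu
      obtain ⟨b, hb⟩ := hlift ↑hsu.unit⁻¹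
      have : φ (a * b - 1) = 0 := by
        rw [map_sub, map_mul, ← hs, hb, ← map_mul, IsUnit.mul_val_inv, map_one, map_one,
          sub_self]
      have h1 := sub_mem (Ideal.mul_mem_right b _ ha) (hIm ((hφ _).mp this))
      rw [sub_sub_cancel] at h1
      exact h1 isUnit_one
    rw [← hyz] at hsm
    obtain ⟨p, q, rfl⟩ := Ideal.mem_span_pair.mp hsm
    obtain ⟨p', hp⟩ := hlift p
    obtain ⟨q', hq⟩ := hlift q
    have : φ (a - (p' * y' + q' * z')) = 0 := by
      simp only [map_sub, map_add, map_mul, ← hs, hp, hq, hy', hz', sub_self]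
    have hpq : p' * y' + q' * z' ∈ Ideal.span {y', z'} := Ideal.mem_span_pair.mpr ⟨p', q', rfl⟩
    have := add_mem (Ideal.mem_sup_left ((hφ _).mp this)) (Ideal.mem_sup_right (S := I) hpq)
    rwa [sub_add_cancel] at this
  · rw [Ideal.span_le]
    rintro a (rfl | rfl)
    · exact hunit _ y hy'.symm hy
    · exact hunit _ z hz'.symm hz
  · rw [← hφ, map_mul, hy', hz', ← map_mul, hπ]
    exact Ideal.mem_span_singleton_self _
  · intro a ha
    obtain ⟨s, hs⟩ := hlift' a
    rw [← hφ, map_mul, map_add, hy', hz', ← hs, ← map_add, ← map_mul, hπ] at ha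
    rw [← hφ, ← hs, hπ]
    exact mem_span_mul_of_add_mul_mem hS hyz ha
  · intro a ha
    obtain ⟨s, hs⟩ := hlift' a
    rw [hmem _ (z * s) (by rw [map_mul, map_mul, hs, hz'])] at ha
    rw [hmem _ s hs]
    exact mem_span_singleton_of_mul_mem hS hyz ha
  · intro h
    obtain ⟨b, hb, v, hv, hbv⟩ := Submodule.mem_sup.mp h
    obtain ⟨u, rfl⟩ := Ideal.mem_span_singleton'.mp hv
    obtain ⟨t, ht⟩ := hlift' u
    have : π (y - t * (y + z)) = 0 := by
      have := congrArg φ hbv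
      rw [map_add, (hφ b).mpr hb, zero_add, map_mul, map_add, hy', hz', ← ht] at this
      rw [map_sub, map_mul, map_add, this, sub_self]
    obtain ⟨c, hc⟩ := Ideal.mem_span_singleton'.mp ((hπ _).mp this)
    exact notMem_span_add_mul hS hyz t c (by linear_combination -hc)

theorem hasHSMultiplicity_of_length_eq (d c : ℕ)
    (h : ∀ n, Module.length R (R ⧸ maximalIdeal R ^ (n + 2)) =
      ((n + 1 + d).choose d + c * (n + d).choose d : ℕ)) :
    HasHSMultiplicity R (maximalIdeal R) d (c + 1) := by
  have hdeg : (Polynomial.preHilbertPoly ℚ d 0 +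
      Polynomial.C (c : ℚ) * Polynomial.preHilbertPoly ℚ d 1).natDegree ≤ d := by
    refine Polynomial.natDegree_add_le_of_degree_le (Polynomial.natDegree_preHilbertPoly ℚ d 0).le ?_
    exact (Polynomial.natDegree_C_mul_le _ _).trans (Polynomial.natDegree_preHilbertPoly ℚ d 1).le
  have hcoeff : (Polynomial.preHilbertPoly ℚ d 0 +
      Polynomial.C (c : ℚ) * Polynomial.preHilbertPoly ℚ d 1).coeff d =
      (c + 1) * (d.factorial : ℚ)⁻¹ := by
    rw [Polynomial.coeff_add, Polynomial.coeff_C_mul, Polynomial.coeff_preHilbertPoly_self,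
      Polynomial.coeff_preHilbertPoly_self]
    ring
  have hd : (d.factorial : ℚ) ≠ 0 := by exact_mod_cast d.factorial_ne_zero
  have hdeg' := Polynomial.natDegree_eq_of_le_of_coeff_ne_zero hdeg (by
    rw [hcoeff]; positivity)
  refine ⟨_, hdeg', ?_, ?_⟩
  · rw [Polynomial.leadingCoeff, hdeg', hcoeff, inv_mul_cancel_right₀ hd]
    push_cast
    rfl
  · filter_upwards [Filter.eventually_ge_atTop 1] with n hn
    refine ⟨(n + d).choose d + c * (n - 1 + d).choose d, ?_, ?_⟩
    · obtain ⟨n, rfl⟩ := Nat.exists_eq_add_of_le' hn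
      rw [← Module.coe_length, h n]
      rfl
    · rw [Polynomial.eval_add, Polynomial.eval_mul, Polynomial.eval_C,
        Polynomial.preHilbertPoly_eq_choose_sub_add ℚ d (Nat.zero_le n),
        Polynomial.preHilbertPoly_eq_choose_sub_add ℚ d hn]
      push_cast
      rfl

theorem Ideal.exists_finset_span_eq_ofList {R : Type*} [CommRing R] (l : List R) :
    ∃ s : Finset R, s.card ≤ l.length ∧ Ideal.span (s : Set R) = Ideal.ofList l := by
  classical
  exact ⟨l.toFinset, l.toFinset_card_le, by rw [List.coe_toFinset]⟩

theorem edim_le_and_hasHSMultiplicity {R : Type*} [CommRing R] [IsLocalRing R]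
    [IsNoetherianRing R] (l g : List R) (c : ℕ) (hc₁ : c ≤ 1)
    (hl : ∀ r ∈ l, r ∈ maximalIdeal R) (h : IsWeaklyRegular R l)
    (hc : Module.length R (R ⧸ Ideal.ofList l) = (1 + c : ℕ))
    (hm : maximalIdeal R ^ 2 = maximalIdeal R * Ideal.ofList l)
    (hg : Ideal.ofList g = maximalIdeal R) (hgl : g.length ≤ l.length + c) :
    (∀ e t : ℕ, HasMinGens R (maximalIdeal R) e →
      HasDepth R (maximalIdeal R) R t → e ≤ t + 1) ∧
    (∀ e : ℕ, HasMinGens R (maximalIdeal R) e →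
      HasHSMultiplicity R (maximalIdeal R) l.length (e - l.length + 1)) := by
  have hpow (n : ℕ) :
      maximalIdeal R ^ (n + 1) = maximalIdeal R * Ideal.ofList l ^ n := by
    induction n with
    | zero => simp
    | succ n ih =>
      rw [pow_succ, ih, mul_right_comm, ← pow_two, hm, mul_assoc, ← pow_succ']
  have hlen (n : ℕ) : Module.length R (R ⧸ maximalIdeal R ^ (n + 2)) =
      ((n + 1 + l.length).choose l.length + c * (n + l.length).choose l.length : ℕ) := by
    have := length_quotient_maximalIdeal_mul_ofList_pow l ⊥ bot_le hl
      ((Submodule.quotEquivOfEqBot (⊥ : Ideal R) rfl).isWeaklyRegular_congr l |>.mpr h) c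
      (by rw [bot_sup_eq, hc]) n
    rwa [bot_sup_eq, ← hpow] at this
  obtain ⟨s, hs, hsg⟩ := Ideal.exists_finset_span_eq_ofList g
  have hle (e : ℕ) (he : HasMinGens R (maximalIdeal R) e) : e ≤ l.length + c :=
    (he.2 s (hsg.trans hg)).trans (hs.trans hgl)
  refine ⟨fun e t he ht => ?_, fun e he => ?_⟩
  · have := ht.2 l hl (.of_isWeaklyRegular_of_mem_maximalIdeal R hl h)
    have := hle e he
    omega
  · obtain ⟨⟨s, rfl, hs⟩, -⟩ := id he
    have h₁ := length_quotient_maximalIdeal_sq_le s hs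
    rw [hlen 0, zero_add, zero_add, Nat.choose_self, add_comm 1,
      Nat.choose_succ_self_right, Nat.cast_le] at h₁
    have h₂ := hle _ he
    rw [show s.card - l.length = c by omega]
    exact hasHSMultiplicity_of_length_eq _ c hlen

end

end

/-- if `R` has positive dimension `d` and an `R`-regular sequence
`x₁,…,x_{d−1}` with `R/(x) ≅ S/(yz)` for a two-dimensional regular local ring `S`
with regular system of parameters `y, z`, then `R` is a hypersurface
(edim R − depth R ≤ 1) with minimal multiplicity `e(R) = edim R − dim R + 1`. -/
theorem stmt16 (R : Type u) [CommRing R] [IsNoetherianRing R] [IsLocalRing R]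
    (d : ℕ) (hd : ringKrullDim R = d) (hdpos : 0 < d)
    (rs : List R) (hlen : rs.length = d - 1)
    (hreg : RingTheory.Sequence.IsRegular R rs)
    (S : Type u) [CommRing S] [IsNoetherianRing S] [IsLocalRing S]
    (hS : ringKrullDim S = 2) (y z : S)
    (hyz : Ideal.span {y, z} = IsLocalRing.maximalIdeal S)
    (iso : (R ⧸ Ideal.ofList rs) ≃+* (S ⧸ Ideal.span {y * z})) :
    (∀ e t : ℕ, HasMinGens R (IsLocalRing.maximalIdeal R) e →
      HasDepth R (IsLocalRing.maximalIdeal R) R t → e ≤ t + 1) ∧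
    (∀ e : ℕ, HasMinGens R (IsLocalRing.maximalIdeal R) e →
      HasHSMultiplicity R (IsLocalRing.maximalIdeal R) d (e - d + 1)) := by
  have hrsI : Ideal.ofList rs ≠ ⊤ := by
    have := hreg.top_ne_smul
    rwa [smul_eq_mul, Ideal.mul_top, ne_comm] at this
  have hrsm : Ideal.ofList rs ≤ IsLocalRing.maximalIdeal R :=
    IsLocalRing.le_maximalIdeal hrsI
  have hrs : ∀ r ∈ rs, r ∈ IsLocalRing.maximalIdeal R :=
    fun r hr => hrsm (Ideal.subset_span hr)
  have hbot (l : List R) :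
      RingTheory.Sequence.IsWeaklyRegular (R ⧸ (⊥ : Ideal R)) l ↔
        RingTheory.Sequence.IsWeaklyRegular R l :=
    (Submodule.quotEquivOfEqBot (⊥ : Ideal R) rfl).isWeaklyRegular_congr l
  have hconcat (l : List R) (x : R) (hl : RingTheory.Sequence.IsWeaklyRegular R l)
      (hx : ∀ a, x * a ∈ Ideal.ofList l → a ∈ Ideal.ofList l) :
      RingTheory.Sequence.IsWeaklyRegular R (l ++ [x]) := by
    rw [← hbot, isWeaklyRegular_quotient_concat_iff, hbot, bot_sup_eq]
    exact ⟨hl, hx⟩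
  obtain ⟨y', z', hm, hyz', hw, hz, hy⟩ := exists_lift_of_quotient_equiv hS hyz _ iso
  have hym : y' ∈ IsLocalRing.maximalIdeal R := by
    rw [hm]; exact Ideal.mem_sup_right (Ideal.subset_span (by simp))
  have hzm : z' ∈ IsLocalRing.maximalIdeal R := by
    rw [hm]; exact Ideal.mem_sup_right (Ideal.subset_span (by simp))
  rcases exists_perm_cons_of_mem_ofList rs hyz' with hyz₂ | ⟨x, l, hperm, hx⟩
  · have hq : Ideal.ofList (rs ++ [y' + z']) = Ideal.ofList rs ⊔ Ideal.span {y' + z'} := by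
      rw [Ideal.ofList_append, Ideal.ofList_singleton]
    have hl : ∀ r ∈ rs ++ [y' + z'], r ∈ IsLocalRing.maximalIdeal R := by
      intro r hr
      rcases List.mem_append.mp hr with hr | hr
      · exact hrs r hr
      · rw [List.mem_singleton.mp hr]; exact add_mem hym hzm
    have hqm := Ideal.ofList_le hl
    have hwq : y' + z' ∈ Ideal.ofList (rs ++ [y' + z']) := Ideal.subset_span (by simp)
    have hrsq : Ideal.ofList rs ≤ Ideal.ofList (rs ++ [y' + z']) := hq ▸ le_sup_left
    have hmq : IsLocalRing.maximalIdeal R =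
        Ideal.ofList (rs ++ [y' + z']) ⊔ Ideal.span {y'} := by
      refine le_antisymm ?_ (sup_le hqm ((Ideal.span_singleton_le_iff_mem _).mpr hym))
      have hy₁ : y' ∈ Ideal.ofList (rs ++ [y' + z']) ⊔ Ideal.span {y'} :=
        Ideal.mem_sup_right (Ideal.mem_span_singleton_self y')
      rw [hm]
      refine sup_le (hrsq.trans le_sup_left) (Ideal.span_le.mpr ?_)
      rintro a (rfl | rfl)
      · exact hy₁
      · have := sub_mem (Ideal.mem_sup_left hwq) hy₁
        rwa [add_sub_cancel_left] at this
    have hsq : IsLocalRing.maximalIdeal R ^ 2 =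
        IsLocalRing.maximalIdeal R * Ideal.ofList (rs ++ [y' + z']) := by
      refine le_antisymm ?_ (by rw [pow_two]; exact Ideal.mul_mono_right hqm)
      rw [pow_two]
      nth_rw 2 [hmq]
      rw [Ideal.mul_sup]
      refine sup_le le_rfl ?_
      nth_rw 1 [hmq]
      rw [Ideal.sup_mul]
      refine sup_le ?_ ?_
      · rw [mul_comm]
        exact Ideal.mul_mono_left ((Ideal.span_singleton_le_iff_mem _).mpr hym)
      · rw [Ideal.span_singleton_mul_span_singleton, Ideal.span_singleton_le_iff_mem]
        have := sub_mem (Ideal.mul_mem_mul hym hwq) (Ideal.mul_mono_right hrsq hyz₂)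
        convert this using 1
        ring
    have hcard : (rs ++ [y' + z']).length = d := by
      rw [List.length_append, List.length_singleton]; omega
    have hlen : Module.length R (R ⧸ Ideal.ofList (rs ++ [y' + z'])) = (1 + 1 : ℕ) := by
      rw [Ideal.length_quotient_eq_add (K := IsLocalRing.maximalIdeal R) (x := y'), ← hmq,
        IsLocalRing.length_quotient_maximalIdeal]
      · rfl
      · refine fun a => ⟨fun ha => ?_, fun ha hau => hy ?_⟩
        · have := Ideal.mul_mem_mul hym ha
          rw [← pow_two, hsq] at this
          exact Ideal.mul_le_right this
        · rw [← hq, ← Ideal.mul_unit_mem_iff_mem _ hau]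
          exact ha
    have hg : Ideal.ofList (y' :: z' :: rs) = IsLocalRing.maximalIdeal R := by
      rw [Ideal.ofList_cons, Ideal.ofList_cons, ← sup_assoc, ← Ideal.span_insert, sup_comm, hm]
    have := edim_le_and_hasHSMultiplicity (rs ++ [y' + z']) (y' :: z' :: rs) 1 le_rfl hl
      (hconcat _ _ hreg.toIsWeaklyRegular hw) hlen hsq hg (by simp)
    rwa [hcard] at this
  · have hle : Ideal.ofList rs = Ideal.span {x} ⊔ Ideal.ofList l := by
      rw [← Ideal.ofList_cons]
      exact congrArg Ideal.span (Set.ext fun r => hperm.mem_iff)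
    have hreg' := IsLocalRing.isWeaklyRegular_of_perm_of_subset_maximalIdeal
      hreg.toIsWeaklyRegular (hperm.trans (List.perm_append_singleton x l).symm) hrs
    rw [← hbot, isWeaklyRegular_quotient_concat_iff, hbot, bot_sup_eq] at hreg'
    obtain ⟨b, v, hv, hbv⟩ := Ideal.mem_span_singleton_sup.mp hx
    have hly : Ideal.ofList (l ++ [y']) = Ideal.ofList rs ⊔ Ideal.span {y'} := by
      rw [Ideal.ofList_append, Ideal.ofList_singleton]
      refine le_antisymm (sup_le_sup_right (hle ▸ le_sup_right) _) (sup_le ?_ le_sup_right)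
      rw [hle]
      refine sup_le ((Ideal.span_singleton_le_iff_mem _).mpr ?_) le_sup_left
      rw [← hbv]
      exact add_mem (Ideal.mem_sup_right (Ideal.mem_span_singleton'.mpr ⟨b * z', by ring⟩))
        (Ideal.mem_sup_left hv)
    have hlm : Ideal.ofList (l ++ [y'] ++ [z']) = IsLocalRing.maximalIdeal R := by
      rw [Ideal.ofList_append, hly, Ideal.ofList_singleton, hm, sup_assoc, ← Ideal.span_insert]
    have hcard : (l ++ [y'] ++ [z']).length = d := by
      have := hperm.length_eq
      simp only [List.length_append, List.length_cons, List.length_nil] at this ⊢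
      omega
    have hly' (a : R) (ha : y' * a ∈ Ideal.ofList l) : a ∈ Ideal.ofList l := by
      refine hreg'.2 a ?_
      rw [← hbv, show (b * (y' * z') + v) * a = b * z' * (y' * a) + a * v by ring]
      exact add_mem (Ideal.mul_mem_left _ _ ha) (Ideal.mul_mem_left _ _ hv)
    have := edim_le_and_hasHSMultiplicity (l ++ [y'] ++ [z']) (l ++ [y'] ++ [z']) 0 zero_le_one
      (fun r hr => hlm ▸ Ideal.subset_span hr)
      (hconcat _ _ (hconcat _ _ hreg'.1 hly') (by rwa [hly]))
      (by rw [hlm, IsLocalRing.length_quotient_maximalIdeal]; rfl)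
      (by rw [hlm, pow_two]) hlm le_rfl
    rwa [hcard] at this
end

section
/- Let (R, m, k) be a commutative noetherian local ring of depth t. If the t-th syzygy Ω^t(k) belongs to add(R ⊕ Ω^{t+1}(k)), then Ω^{t+1}(k) belongs to add(R ⊕ Ω^{t+2}(k)). -/
universe u

/-- A map killed by `g` factors through the kernel of `g`. -/
theorem exists_comp_eq_of_range_eq_ker {R A B C D : Type*} [CommRing R]
    [AddCommGroup A] [Module R A] [AddCommGroup B] [Module R B]
    [AddCommGroup C] [Module R C] [AddCommGroup D] [Module R D]
    {f : A →ₗ[R] B} {g : B →ₗ[R] C} (hf : Function.Injective f)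
    (hfg : LinearMap.range f = LinearMap.ker g) (h : D →ₗ[R] B) (hgh : ∀ x, g (h x) = 0) :
    ∃ l : D →ₗ[R] A, ∀ x, f (l x) = h x := by
  have hmem : ∀ x, h x ∈ LinearMap.range f := fun x => by
    rw [hfg, LinearMap.mem_ker, hgh]
  refine ⟨(LinearEquiv.ofInjective f hf).symm.toLinearMap ∘ₗ h.codRestrict _ hmem, fun x => ?_⟩
  exact congrArg Subtype.val
    ((LinearEquiv.ofInjective f hf).apply_symm_apply (h.codRestrict _ hmem x))

/-- A module which is a retract of `Cʳ ⊕ Rⁿ` lies in `add (R ⊕ C)`. -/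
theorem inAddClosure_of_comp_add_comp_eq_id {R B C : Type u} [CommRing R]
    [AddCommGroup B] [Module R B] [AddCommGroup C] [Module R C] {r n : ℕ}
    (α : B →ₗ[R] (Fin r → C)) (β : (Fin r → C) →ₗ[R] B)
    (f : B →ₗ[R] (Fin n → R)) (h : (Fin n → R) →ₗ[R] B)
    (hid : ∀ x, β (α x) + h (f x) = x) : InAddClosure R B (R × C) := by
  refine ⟨r + n, LinearMap.pi (Fin.append
      (fun a => LinearMap.inr R R C ∘ₗ LinearMap.proj a ∘ₗ α)
      (fun c => LinearMap.inl R R C ∘ₗ LinearMap.proj c ∘ₗ f)),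
    β ∘ₗ LinearMap.pi (fun a => LinearMap.snd R R C ∘ₗ LinearMap.proj (Fin.castAdd n a)) +
      h ∘ₗ LinearMap.pi (fun c => LinearMap.fst R R C ∘ₗ LinearMap.proj (Fin.natAdd r c)), ?_⟩
  ext x
  refine Eq.trans ?_ (hid x)
  simp only [LinearMap.comp_apply, LinearMap.add_apply]
  congr 2 <;> ext a <;> simp

/-- Membership in `add (R ⊕ -)` passes to syzygies. -/
theorem InAddClosure.of_existsSES {R A B C : Type u} [CommRing R]
    [AddCommGroup A] [Module R A] [AddCommGroup B] [Module R B] [AddCommGroup C] [Module R C]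
    {n m : ℕ} (hA : ExistsSES R B (Fin n → R) A) (hB : ExistsSES R C (Fin m → R) B)
    (h : InAddClosure R A (R × B)) : InAddClosure R B (R × C) := by
  obtain ⟨f, g, hf, hg, hfg⟩ := hA
  obtain ⟨f', g', hf', hg', hfg'⟩ := hB
  obtain ⟨r, i, p, hpi⟩ := h
  have hgf : ∀ x, g (f x) = 0 := fun x =>
    LinearMap.mem_ker.1 (hfg ▸ LinearMap.mem_range_self f x)
  let q : (Fin r → R × (Fin m → R)) →ₗ[R] (Fin r → R × B) :=
    LinearMap.compLeft (LinearMap.prodMap LinearMap.id g') (Fin r)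
  let j : (Fin r → C) →ₗ[R] (Fin r → R × (Fin m → R)) :=
    LinearMap.compLeft (LinearMap.inr R R _ ∘ₗ f') (Fin r)
  have hq : Function.Surjective q :=
    (Function.surjective_id.prodMap hg').comp_left
  have hj : Function.Injective j :=
    (LinearMap.inr_injective.comp hf').comp_left
  have hjq : LinearMap.range j = LinearMap.ker q := by
    ext y
    constructor
    · rintro ⟨c, rfl⟩
      have hgf' : ∀ x, g' (f' x) = 0 := fun x =>
        LinearMap.mem_ker.1 (hfg' ▸ LinearMap.mem_range_self f' x)
      ext a <;> simp [q, j, hgf']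
    · intro hy
      have hy' : ∀ a, (y a).1 = 0 ∧ g' (y a).2 = 0 := fun a =>
        Prod.ext_iff.1 (congrFun (LinearMap.mem_ker.1 hy) a)
      have hmem : ∀ a, ∃ c, f' c = (y a).2 := fun a =>
        LinearMap.mem_range.1 (hfg' ▸ LinearMap.mem_ker.2 (hy' a).2)
      choose c hc using hmem
      refine ⟨c, funext fun a => Prod.ext (hy' a).1.symm (hc a)⟩
  have hqj : ∀ c, q (j c) = 0 := fun c =>
    LinearMap.mem_ker.1 (hjq ▸ LinearMap.mem_range_self j c)
  obtain ⟨I, hI⟩ := Module.projective_lifting_property q (i ∘ₗ g) hq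
  obtain ⟨P, hP⟩ := Module.projective_lifting_property g (p ∘ₗ q) hg
  replace hI : ∀ x, q (I x) = i (g x) := LinearMap.congr_fun hI
  replace hP : ∀ x, g (P x) = p (q x) := LinearMap.congr_fun hP
  replace hpi : ∀ x, p (i x) = x := LinearMap.congr_fun hpi
  obtain ⟨α, hα⟩ := exists_comp_eq_of_range_eq_ker hj hjq (I ∘ₗ f) (by simp [hI, hgf])
  obtain ⟨β, hβ⟩ := exists_comp_eq_of_range_eq_ker hf hfg (P ∘ₗ j) (by simp [hP, hqj])
  obtain ⟨s, hs⟩ := exists_comp_eq_of_range_eq_ker hf hfg (LinearMap.id - P ∘ₗ I)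
    (by simp [hP, hI, hpi])
  refine inAddClosure_of_comp_add_comp_eq_id α β f s fun x => hf ?_
  simp [hβ, hα, hs]

/-- The short exact sequence `0 → Ωⁿ⁺¹ → Fₙ → Ωⁿ → 0`. -/
theorem MinFreeRes.existsSES {R : Type u} [CommRing R] {𝔪 : Ideal R} {M : Type u}
    [AddCommGroup M] [Module R M] (F : MinFreeRes R 𝔪 M) :
    ∀ n, ExistsSES R (F.Syz (n + 1)) (Fin (F.b n) → R) (F.Syz n)
  | 0 => ⟨(LinearMap.range (F.d 0)).subtype, F.aug, Subtype.val_injective, F.aug_surj,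
      (Submodule.range_subtype _).trans F.exact_aug⟩
  | n + 1 => ⟨(LinearMap.range (F.d (n + 1))).subtype, (F.d n).rangeRestrict,
      Subtype.val_injective, LinearMap.surjective_rangeRestrict _,
      (Submodule.range_subtype _).trans ((F.exact n).trans (LinearMap.ker_rangeRestrict _).symm)⟩

/-- if `Ω^t(k) ∈ add(R ⊕ Ω^{t+1}(k))`, then
`Ω^{t+1}(k) ∈ add(R ⊕ Ω^{t+2}(k))`, where `t = depth R`. -/
theorem stmt17 (R : Type u) [CommRing R] [IsNoetherianRing R] [IsLocalRing R]
    (t : ℕ) (ht : HasDepth R (IsLocalRing.maximalIdeal R) R t) :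
    ∀ F : MinFreeRes R (IsLocalRing.maximalIdeal R) (IsLocalRing.ResidueField R),
      InAddClosure R (F.Syz t) (R × F.Syz (t + 1)) →
      InAddClosure R (F.Syz (t + 1)) (R × F.Syz (t + 2)) := by
  intro F h
  exact h.of_existsSES (F.existsSES t) (F.existsSES (t + 1))
end

section
/- Let (R, m, k) be a commutative noetherian local ring of depth t, and suppose there exist integers n, m with 1 ≤ n ≤ t+1 and 0 ≤ m ≤ n such that Ω^m(k) ∈ add(R ⊕ Ω^{n+1}(k)). Then either Ω^{t+1}(k) ∈ add(R ⊕ Ω^{t+2}(k)) or Ω^t(k) ∈ add(R ⊕ Ω^{t+2}(k)). -/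
universe u

namespace MinFreeRes

open IsLocalRing

section

variable {R : Type u} [CommRing R] {𝔪 : Ideal R}
  {M : Type u} [AddCommGroup M] [Module R M]

/-- The surjection from the `n`-th free module onto the `n`-th syzygy. -/
def cover (F : MinFreeRes R 𝔪 M) : ∀ n, (Fin (F.b n) → R) →ₗ[R] F.Syz n
  | 0 => F.aug
  | n + 1 => (F.d n).rangeRestrict

/-- The inclusion of the `(n+1)`-st syzygy into the `n`-th free module. -/
def incl (F : MinFreeRes R 𝔪 M) (n : ℕ) : F.Syz (n + 1) →ₗ[R] (Fin (F.b n) → R) :=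
  (LinearMap.range (F.d n)).subtype

lemma cover_surjective (F : MinFreeRes R 𝔪 M) : ∀ n, Function.Surjective (F.cover n)
  | 0 => F.aug_surj
  | n + 1 => (F.d n).surjective_rangeRestrict

lemma incl_injective (F : MinFreeRes R 𝔪 M) (n : ℕ) : Function.Injective (F.incl n) :=
  Subtype.val_injective

lemma range_incl (F : MinFreeRes R 𝔪 M) (n : ℕ) :
    LinearMap.range (F.incl n) = LinearMap.range (F.d n) :=
  Submodule.range_subtype _

lemma exact_incl_cover (F : MinFreeRes R 𝔪 M) (n : ℕ) :
    Function.Exact (F.incl n) (F.cover n) := by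
  rw [LinearMap.exact_iff, range_incl]
  cases n with
  | zero => exact F.exact_aug.symm
  | succ n => exact (LinearMap.ker_rangeRestrict _).trans (F.exact n).symm

lemma cover_incl (F : MinFreeRes R 𝔪 M) (n : ℕ) (y : F.Syz (n + 1)) :
    F.cover n (F.incl n y) = 0 :=
  (F.exact_incl_cover n).apply_apply_eq_zero y

/-- Vanishing of `Ext^j(M, N)`, expressed as an extension property along the syzygies of `M`. -/
def ExtVanishes (F : MinFreeRes R 𝔪 M) (N : Type u) [AddCommGroup N] [Module R N] : ℕ → Prop
  | 0 => ∀ f : F.Syz 0 →ₗ[R] N, f = 0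
  | j + 1 => ∀ f : F.Syz (j + 1) →ₗ[R] N,
      ∃ g : (Fin (F.b j) → R) →ₗ[R] N, g ∘ₗ F.incl j = f

end

end MinFreeRes

/-- A map that is killed by `p` factors through an injection `i` onto the kernel of `p`. -/
lemma exists_comp_eq_of_exact {R A B C P : Type*} [CommRing R]
    [AddCommGroup A] [Module R A] [AddCommGroup B] [Module R B] [AddCommGroup C] [Module R C]
    [AddCommGroup P] [Module R P] {i : A →ₗ[R] B} {p : B →ₗ[R] C}
    (hi : Function.Injective i) (hip : Function.Exact i p) (g : P →ₗ[R] B)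
    (hg : ∀ y, p (g y) = 0) : ∃ h : P →ₗ[R] A, i ∘ₗ h = g := by
  have hmem : ∀ y, g y ∈ LinearMap.range i := fun y => (hip (g y)).1 (hg y)
  refine ⟨(LinearEquiv.ofInjective i hi).symm.toLinearMap ∘ₗ g.codRestrict _ hmem, ?_⟩
  ext y
  have := LinearEquiv.apply_symm_apply (LinearEquiv.ofInjective i hi) ⟨g y, hmem y⟩
  exact congrArg Subtype.val this

/-- A map that kills `i` descends along a surjection `p` with kernel the range of `i`. -/
lemma exists_comp_eq_of_exact_of_surjective {R A B C N : Type*} [CommRing R]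
    [AddCommGroup A] [Module R A] [AddCommGroup B] [Module R B] [AddCommGroup C] [Module R C]
    [AddCommGroup N] [Module R N] {i : A →ₗ[R] B} {p : B →ₗ[R] C}
    (hip : Function.Exact i p) (hp : Function.Surjective p) (g : B →ₗ[R] N)
    (hg : ∀ y, g (i y) = 0) : ∃ h : C →ₗ[R] N, h ∘ₗ p = g := by
  have hker : LinearMap.ker p ≤ LinearMap.ker g := by
    intro y hy
    obtain ⟨z, rfl⟩ := (hip y).1 hy
    exact hg z
  refine ⟨(LinearMap.ker p).liftQ g hker ∘ₗ (p.quotKerEquivOfSurjective hp).symm.toLinearMap, ?_⟩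
  ext y
  have : (p.quotKerEquivOfSurjective hp).symm (p y) = (LinearMap.ker p).mkQ y :=
    (LinearEquiv.symm_apply_eq _).2 rfl
  simp [this]

namespace MinFreeRes

open IsLocalRing

section

variable {R : Type u} [CommRing R] {𝔪 : Ideal R}
  {M : Type u} [AddCommGroup M] [Module R M]

/-- Dimension shifting: if `Ext^j(M, C)` vanishes, a class in `Ext^(j+1)(M, A)` that dies in
`Ext^(j+1)(M, B)` is trivial. -/
lemma ExtVanishes.exists_extension {F : MinFreeRes R 𝔪 M} {A B C : Type u}
    [AddCommGroup A] [Module R A] [AddCommGroup B] [Module R B] [AddCommGroup C] [Module R C]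
    {j : ℕ} (hC : F.ExtVanishes C j) {i : A →ₗ[R] B} {p : B →ₗ[R] C}
    (hi : Function.Injective i) (hip : Function.Exact i p) (hp : Function.Surjective p)
    (f : F.Syz (j + 1) →ₗ[R] A) (g : (Fin (F.b j) → R) →ₗ[R] B)
    (hg : ∀ y, g (F.incl j y) = i (f y)) :
    ∃ h : (Fin (F.b j) → R) →ₗ[R] A, h ∘ₗ F.incl j = f := by
  obtain ⟨q, hq⟩ := exists_comp_eq_of_exact_of_surjective (F.exact_incl_cover j)
    (F.cover_surjective j) (p ∘ₗ g) (fun y => by simp [hg, hip.apply_apply_eq_zero])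
  obtain ⟨g₀, hg₀, hpg₀⟩ : ∃ g₀ : (Fin (F.b j) → R) →ₗ[R] B,
      (∀ y, g₀ (F.incl j y) = 0) ∧ ∀ y, p (g₀ y) = p (g y) := by
    have hq' : ∀ y, q (F.cover j y) = p (g y) := fun y => LinearMap.congr_fun hq y
    cases j with
    | zero => exact ⟨0, fun _ => rfl, fun y => by simp [← hq', hC q]⟩
    | succ j =>
      obtain ⟨r, rfl⟩ := hC q
      obtain ⟨s, hs⟩ := Module.projective_lifting_property p r hp
      refine ⟨s ∘ₗ F.incl j ∘ₗ F.cover (j + 1), fun y => by simp [cover_incl], fun y => ?_⟩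
      rw [← hq', ← hs]
      rfl
  obtain ⟨h, hh⟩ := exists_comp_eq_of_exact hi hip (g - g₀) (fun y => by simp [hpg₀])
  refine ⟨h, LinearMap.ext fun y => hi ?_⟩
  have := LinearMap.congr_fun hh (F.incl j y)
  simpa [hg, hg₀] using this

lemma ExtVanishes.of_exact {F : MinFreeRes R 𝔪 M} {A B C : Type u}
    [AddCommGroup A] [Module R A] [AddCommGroup B] [Module R B] [AddCommGroup C] [Module R C]
    {j : ℕ} (hC : F.ExtVanishes C j) (hB : F.ExtVanishes B (j + 1))
    {i : A →ₗ[R] B} {p : B →ₗ[R] C}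
    (hi : Function.Injective i) (hip : Function.Exact i p) (hp : Function.Surjective p) :
    F.ExtVanishes A (j + 1) := by
  intro f
  obtain ⟨g, hg⟩ := hB (i ∘ₗ f)
  exact hC.exists_extension hi hip hp f g (LinearMap.congr_fun hg)

lemma ExtVanishes.of_injective {F : MinFreeRes R 𝔪 M} {A B : Type u}
    [AddCommGroup A] [Module R A] [AddCommGroup B] [Module R B]
    (hB : F.ExtVanishes B 0) {i : A →ₗ[R] B} (hi : Function.Injective i) :
    F.ExtVanishes A 0 := fun f => LinearMap.ext fun y =>
  hi (by simpa using LinearMap.congr_fun (hB (i ∘ₗ f)) y)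

lemma ExtVanishes.pi {F : MinFreeRes R 𝔪 M} {ι : Type} {A : Type u}
    [AddCommGroup A] [Module R A] {j : ℕ} (hA : F.ExtVanishes A j) :
    F.ExtVanishes (ι → A) j := by
  cases j with
  | zero =>
    intro f
    ext y c
    exact LinearMap.congr_fun (hA (LinearMap.proj c ∘ₗ f)) y
  | succ j =>
    intro f
    choose g hg using fun c => hA (LinearMap.proj c ∘ₗ f)
    refine ⟨LinearMap.pi g, LinearMap.ext fun y => funext fun c => ?_⟩
    exact LinearMap.congr_fun (hg c) y

lemma ExtVanishes.prod {F : MinFreeRes R 𝔪 M} {A B : Type u}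
    [AddCommGroup A] [Module R A] [AddCommGroup B] [Module R B]
    {j : ℕ} (hA : F.ExtVanishes A j) (hB : F.ExtVanishes B j) :
    F.ExtVanishes (A × B) j := by
  cases j with
  | zero =>
    intro f
    refine LinearMap.ext fun y => Prod.ext ?_ ?_
    · exact LinearMap.congr_fun (hA (LinearMap.fst R A B ∘ₗ f)) y
    · exact LinearMap.congr_fun (hB (LinearMap.snd R A B ∘ₗ f)) y
  | succ j =>
    intro f
    obtain ⟨g, hg⟩ := hA (LinearMap.fst R A B ∘ₗ f)
    obtain ⟨h, hh⟩ := hB (LinearMap.snd R A B ∘ₗ f)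
    refine ⟨g.prod h, LinearMap.ext fun y => Prod.ext ?_ ?_⟩
    · exact LinearMap.congr_fun hg y
    · exact LinearMap.congr_fun hh y

/-- Vanishing of `Ext` into the ring passes to syzygies. -/
lemma ExtVanishes.syz {F : MinFreeRes R 𝔪 M} {t : ℕ}
    (hR : ∀ j < t, F.ExtVanishes R j) {j n : ℕ} (hj : j < t) (hjn : j ≤ n) :
    F.ExtVanishes (F.Syz (n + 1)) j := by
  induction j generalizing n with
  | zero => exact (hR 0 hj).pi.of_injective (F.incl_injective n)
  | succ j ih =>
    obtain ⟨n, rfl⟩ : ∃ k, n = k + 1 := ⟨n - 1, by omega⟩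
    exact (ih (by omega) (by omega)).of_exact (hR _ hj).pi (F.incl_injective _)
      (F.exact_incl_cover _) (F.cover_surjective _)

/-- Multiplication by an element annihilating `M` is null-homotopic on a free resolution. -/
lemma exists_extension_smul (F : MinFreeRes R 𝔪 M) {x : R} (hx : ∀ y : M, x • y = 0) (j : ℕ) :
    ∃ σ : (Fin (F.b j) → R) →ₗ[R] F.Syz (j + 1), ∀ y, σ (F.incl j y) = x • y := by
  induction j with
  | zero =>
    obtain ⟨h, hh⟩ := exists_comp_eq_of_exact (F.incl_injective 0) (F.exact_incl_cover 0)
      (x • LinearMap.id) (fun y => (map_smul (F.cover 0) x y).trans (hx _))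
    refine ⟨h, fun y => F.incl_injective 0 ?_⟩
    simpa using LinearMap.congr_fun hh (F.incl 0 y)
  | succ j ih =>
    obtain ⟨σ, hσ⟩ := ih
    obtain ⟨τ, hτ⟩ := Module.projective_lifting_property _ σ (F.cover_surjective (j + 1))
    obtain ⟨h, hh⟩ := exists_comp_eq_of_exact (F.incl_injective (j + 1))
      (F.exact_incl_cover (j + 1))
      (x • LinearMap.id - τ ∘ₗ F.incl j ∘ₗ F.cover (j + 1)) (fun y => by
        have := LinearMap.congr_fun hτ (F.incl j (F.cover (j + 1) y))
        simp only [LinearMap.comp_apply] at this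
        simp [this, hσ])
    refine ⟨h, fun y => F.incl_injective _ ?_⟩
    simpa [cover_incl] using LinearMap.congr_fun hh (F.incl (j + 1) y)

open Pointwise in
/-- A weakly regular sequence on `N` annihilating `M` forces `Ext^j(M, N)` to vanish for `j` below
its length. -/
lemma ExtVanishes.of_isWeaklyRegular (F : MinFreeRes R 𝔪 M) {N : Type u} [AddCommGroup N]
    [Module R N] {rs : List R} (hrs : ∀ x ∈ rs, ∀ y : M, x • y = 0)
    (hreg : RingTheory.Sequence.IsWeaklyRegular N rs) {j : ℕ} (hj : j < rs.length) :
    F.ExtVanishes N j := by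
  induction rs generalizing N j with
  | nil => simp at hj
  | cons x rs ih =>
    rw [RingTheory.Sequence.isWeaklyRegular_cons_iff] at hreg
    have hx := hrs x (by simp)
    cases j with
    | zero =>
      intro f
      refine LinearMap.ext fun y => hreg.1 ?_
      have hxy : x • f y = 0 :=
        (map_smul f x y).symm.trans ((congrArg f (hx y)).trans (map_zero f))
      exact hxy.trans (smul_zero x).symm
    | succ j =>
      intro f
      obtain ⟨σ, hσ⟩ := F.exists_extension_smul hx j
      have hC := ih (fun z hz => hrs z (by simp [hz])) hreg.2 (j := j) (by simpa using hj)
      refine hC.exists_extension (i := LinearMap.lsmul R N x)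
        (p := (x • (⊤ : Submodule R N)).mkQ) hreg.1 ?_ (Submodule.mkQ_surjective _) f (f ∘ₗ σ)
        (fun y => by simp [hσ])
      intro y
      simp [Submodule.mem_smul_pointwise_iff_exists]

end

section

variable {R : Type u} [CommRing R] [IsLocalRing R]

/-- A syzygy in a minimal resolution that is a direct summand of the free module covering it
vanishes. -/
lemma subsingleton_syz_of_retraction {M : Type u} [AddCommGroup M] [Module R M]
    (F : MinFreeRes R (maximalIdeal R) M) {n : ℕ}
    (g : (Fin (F.b n) → R) →ₗ[R] F.Syz (n + 1)) (hg : ∀ y, g (F.incl n y) = y) :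
    Subsingleton (F.Syz (n + 1)) := by
  have hfin : Module.Finite R (F.Syz (n + 1)) :=
    Module.Finite.of_surjective _ (F.cover_surjective (n + 1))
  have h : (⊤ : Submodule R (F.Syz (n + 1))) ≤ maximalIdeal R • ⊤ := by
    intro y _
    have h1 : F.incl n y ∈ maximalIdeal R • (⊤ : Submodule R (Fin (F.b n) → R)) :=
      F.minimal n (F.range_incl n ▸ LinearMap.mem_range_self _ y)
    have h2 := Submodule.mem_map_of_mem (f := g) h1
    rw [Submodule.map_smul'', hg] at h2
    exact Submodule.smul_mono le_rfl le_top h2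
  have := Submodule.eq_bot_of_le_smul_of_le_jacobson_bot _ _ hfin.fg_top h
    (IsLocalRing.maximalIdeal_le_jacobson _)
  exact (Submodule.subsingleton_iff R).1 (subsingleton_of_bot_eq_top this.symm)

/-- If `Ext^j(M, R) = 0` for all `j < t`, then for `m < t` the syzygy `Ω^m(M)` is never a summand
of a module `N` with `Ext^m(M, N) = 0`. -/
lemma not_isDirectSummand_syz {M : Type u} [AddCommGroup M] [Module R M] [Nontrivial M]
    (F : MinFreeRes R (maximalIdeal R) M)
    {t : ℕ} (hR : ∀ j < t, F.ExtVanishes R j) {m : ℕ} (hm : m < t) {N : Type u}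
    [AddCommGroup N] [Module R N] (hN : F.ExtVanishes N m) :
    ¬ IsDirectSummand R (F.Syz m) N := by
  induction m generalizing N with
  | zero =>
    rintro ⟨i, p, hip⟩
    obtain ⟨y, hy⟩ := exists_ne (0 : M)
    have : p (i y) = y := LinearMap.congr_fun hip y
    rw [hN i] at this
    exact hy (this.symm.trans (map_zero p))
  | succ m ih =>
    rintro ⟨i, p, hip⟩
    obtain ⟨g, hg⟩ := hN i
    have hsub := F.subsingleton_syz_of_retraction (p ∘ₗ g) (fun y => by
      rw [LinearMap.comp_apply, ← LinearMap.comp_apply g, hg]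
      exact LinearMap.congr_fun hip y)
    have hinj : Function.Injective (F.cover m) := by
      rw [injective_iff_map_eq_zero]
      intro y hy
      obtain ⟨z, rfl⟩ := (F.exact_incl_cover m y).1 hy
      rw [Subsingleton.elim z 0, map_zero]
    let e := LinearEquiv.ofBijective _ ⟨hinj, F.cover_surjective m⟩
    exact ih (by omega) (hR m (by omega)).pi
      ⟨e.symm.toLinearMap, e.toLinearMap, LinearMap.ext fun y => e.apply_symm_apply y⟩

end

end MinFreeRes

/-- A module whose identity is a finite sum of maps factoring through `X` lies in `add X`. -/
lemma InAddClosure.of_sum {R : Type u} [CommRing R] {S X : Type u} [AddCommGroup S] [Module R S]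
    [AddCommGroup X] [Module R X] {ι : Type*} [Fintype ι] (i : ι → S →ₗ[R] X) (p : ι → X →ₗ[R] S)
    (h : ∀ y, ∑ c, p c (i c y) = y) : InAddClosure R S X := by
  let e := Fintype.equivFin ι
  refine ⟨Fintype.card ι, LinearMap.pi fun c => i (e.symm c),
    ∑ c, p (e.symm c) ∘ₗ LinearMap.proj c, LinearMap.ext fun y => ?_⟩
  simp only [LinearMap.comp_apply, LinearMap.sum_apply, LinearMap.proj_apply, LinearMap.pi_apply,
    LinearMap.id_apply]
  rw [e.symm.sum_comp fun c => p c (i c y), h]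

namespace MinFreeRes

/-- Membership in `add (R ⊕ -)` passes to syzygies. -/
lemma inAddClosure_syz_succ {R : Type u} [CommRing R] {𝔪 : Ideal R}
    {M : Type u} [AddCommGroup M] [Module R M] (F : MinFreeRes R 𝔪 M) {m n : ℕ}
    (h : InAddClosure R (F.Syz m) (R × F.Syz n)) :
    InAddClosure R (F.Syz (m + 1)) (R × F.Syz (n + 1)) := by
  obtain ⟨r, i, p, hip⟩ := h
  let c : (Fin r → R × (Fin (F.b n) → R)) →ₗ[R] (Fin r → R × F.Syz n) :=
    LinearMap.piMap fun _ => LinearMap.id.prodMap (F.cover n)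
  have hc : Function.Surjective c :=
    Function.Surjective.piMap fun _ =>
      Function.Surjective.prodMap Function.surjective_id (F.cover_surjective n)
  let k : (Fin r → F.Syz (n + 1)) →ₗ[R] (Fin r → R × (Fin (F.b n) → R)) :=
    LinearMap.piMap fun _ => LinearMap.inr R _ _ ∘ₗ F.incl n
  have hk : Function.Injective k :=
    Function.Injective.piMap fun _ => LinearMap.inr_injective.comp (F.incl_injective n)
  have hkc : Function.Exact k c := by
    intro y
    constructor
    · intro hy
      have hy' : ∀ a, (y a).1 = 0 ∧ F.cover n (y a).2 = 0 := fun a =>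
        Prod.ext_iff.1 (congrFun hy a)
      choose z hz using fun a => (F.exact_incl_cover n (y a).2).1 (hy' a).2
      exact ⟨z, funext fun a => Prod.ext (hy' a).1.symm (hz a)⟩
    · rintro ⟨z, rfl⟩
      exact funext fun a => Prod.ext rfl (F.cover_incl n (z a))
  obtain ⟨i', hi'⟩ := Module.projective_lifting_property c (i ∘ₗ F.cover m) hc
  obtain ⟨p', hp'⟩ := Module.projective_lifting_property (F.cover m) (p ∘ₗ c)
    (F.cover_surjective m)
  have hi'' : ∀ y, c (i' y) = i (F.cover m y) := LinearMap.congr_fun hi'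
  have hp'' : ∀ y, F.cover m (p' y) = p (c y) := LinearMap.congr_fun hp'
  have hip' : ∀ y, p (i y) = y := LinearMap.congr_fun hip
  obtain ⟨a, ha⟩ := exists_comp_eq_of_exact hk hkc (i' ∘ₗ F.incl m)
    (fun y => by simp [hi'', cover_incl])
  obtain ⟨b, hb⟩ := exists_comp_eq_of_exact (F.incl_injective m) (F.exact_incl_cover m)
    (p' ∘ₗ k) (fun y => by simp [hp'', hkc.apply_apply_eq_zero])
  obtain ⟨s, hs⟩ := exists_comp_eq_of_exact (F.incl_injective m) (F.exact_incl_cover m)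
    (LinearMap.id - p' ∘ₗ i') (fun y => by simp [hp'', hi'', hip'])
  have key : ∀ y, b (a y) + s (F.incl m y) = y := by
    intro y
    apply F.incl_injective m
    have h1 : F.incl m (b (a y)) = p' (k (a y)) := LinearMap.congr_fun hb (a y)
    have h2 : k (a y) = i' (F.incl m y) := LinearMap.congr_fun ha y
    have h3 : F.incl m (s (F.incl m y)) = F.incl m y - p' (i' (F.incl m y)) :=
      LinearMap.congr_fun hs (F.incl m y)
    rw [map_add, h1, h2, h3, add_sub_cancel]
  refine InAddClosure.of_sum (ι := Fin r ⊕ Fin (F.b m))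
    (Sum.elim (fun j => LinearMap.inr R _ _ ∘ₗ LinearMap.proj j ∘ₗ a)
      (fun j => LinearMap.inl R _ _ ∘ₗ LinearMap.proj j ∘ₗ F.incl m))
    (Sum.elim (fun j => b ∘ₗ LinearMap.single R _ j ∘ₗ LinearMap.snd R _ _)
      (fun j => s ∘ₗ LinearMap.single R _ j ∘ₗ LinearMap.fst R _ _)) fun y => ?_
  rw [Fintype.sum_sum_type]
  refine Eq.trans ?_ (key y)
  congr 1
  · simp only [Sum.elim_inl, LinearMap.comp_apply, LinearMap.snd_apply, LinearMap.inr_apply,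
      LinearMap.coe_single, LinearMap.proj_apply]
    rw [← map_sum, Finset.univ_sum_single]
  · simp only [Sum.elim_inr, LinearMap.comp_apply, LinearMap.fst_apply, LinearMap.inl_apply,
      LinearMap.coe_single, LinearMap.proj_apply]
    rw [← map_sum, Finset.univ_sum_single]

end MinFreeRes

/-- if `Ω^m(k) ∈ add(R ⊕ Ω^{n+1}(k))` for some `1 ≤ n ≤ t+1` and
`0 ≤ m ≤ n`, then `Ω^{t+1}(k) ∈ add(R ⊕ Ω^{t+2}(k))` or
`Ω^t(k) ∈ add(R ⊕ Ω^{t+2}(k))`, where `t = depth R`. -/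
theorem stmt18 (R : Type u) [CommRing R] [IsNoetherianRing R] [IsLocalRing R]
    (t : ℕ) (ht : HasDepth R (IsLocalRing.maximalIdeal R) R t) :
    ∀ F : MinFreeRes R (IsLocalRing.maximalIdeal R) (IsLocalRing.ResidueField R),
      (∃ n m : ℕ, 1 ≤ n ∧ n ≤ t + 1 ∧ m ≤ n ∧
        InAddClosure R (F.Syz m) (R × F.Syz (n + 1))) →
      (InAddClosure R (F.Syz (t + 1)) (R × F.Syz (t + 2)) ∨
        InAddClosure R (F.Syz t) (R × F.Syz (t + 2))) := by
  rintro F ⟨n, m, -, hnt, hmn, h⟩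
  obtain ⟨⟨rs, hlen, hmem, hreg⟩, -⟩ := ht
  have hR : ∀ j < t, F.ExtVanishes R j := fun j hj =>
    MinFreeRes.ExtVanishes.of_isWeaklyRegular F (fun x hx y => by
      rw [Algebra.smul_def, IsLocalRing.ResidueField.algebraMap_eq,
        (IsLocalRing.residue_eq_zero_iff x).2 (hmem x hx), zero_mul])
      hreg.toIsWeaklyRegular (hlen.symm ▸ hj)
  have hmt : t ≤ m := by
    by_contra! hlt
    obtain ⟨r, hr⟩ := h
    exact F.not_isDirectSummand_syz hR hlt
      ((hR m hlt).prod (MinFreeRes.ExtVanishes.syz hR hlt hmn)).pi hr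
  obtain rfl | rfl : n = t ∨ n = t + 1 := by omega
  · obtain rfl : m = n := by omega
    exact Or.inl (F.inAddClosure_syz_succ h)
  · obtain rfl | rfl : m = t ∨ m = t + 1 := by omega
    · exact Or.inr h
    · exact Or.inl h
end
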